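/- arXiv:math/0608352 — 3 statements merged into one kernel-verified Lean document; each statement's English description precedes it below -/
import Mathlib

section
/- Assume lim_{N→∞} d_U(A_N, A) = 0. Then for every function f : ℝ^r → ℝ of class C² and every T > 0, lim_{N→∞} sup_{0 ≤ t ≤ T} sup_{p ∈ K_N} | N·(S_{N,[Nt]} f(p) − f(p)) − G_A(t) f(p) | = 0. -/
open scoped BigOperators NNReal
open Finset MeasureTheory

noncomputable section

/-- A Q-matrix: nonnegative off-diagonal entries, rows summing to zero. -/
def IsQMatrix {r : ℕ} (M : Matrix (Fin r) (Fin r) ℝ) : Prop :=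
  (∀ i j, i ≠ j → 0 ≤ M i j) ∧ ∀ i, ∑ j, M i j = 0

/-- A stochastic matrix: nonnegative entries, rows summing to one. -/
def IsStochastic {r : ℕ} (M : Matrix (Fin r) (Fin r) ℝ) : Prop :=
  (∀ i j, 0 ≤ M i j) ∧ ∀ i, ∑ j, M i j = 1

/-- Frobenius norm of an `r×r` real matrix. -/
def frobNorm {r : ℕ} (M : Matrix (Fin r) (Fin r) ℝ) : ℝ :=
  Real.sqrt (∑ i, ∑ j, (M i j) ^ 2)

/-- The metric `d_U(x,y) = ∫₀^∞ e^{-u} sup_{0≤t≤u} (‖x(t)−y(t)‖ ∧ 1) du` on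
matrix-valued paths. -/
def dU {r : ℕ} (x y : ℝ → Matrix (Fin r) (Fin r) ℝ) : ℝ :=
  ∫ u in Set.Ioi (0 : ℝ),
    Real.exp (-u) * sSup ((fun t => min (frobNorm (x t - y t)) 1) '' Set.Icc 0 u)

/-- Multinomial probability weight `(∑β)!/∏ β_j! · ∏ p_j^{β_j}`. -/
def multinomialWeight {r : ℕ} (p : Fin r → ℝ) (β : Fin r → ℕ) : ℝ :=
  (Nat.multinomial Finset.univ β : ℝ) * ∏ j, p j ^ β j

/-- The internal-dynamics transition operator: `SOp N P f n = S_{N} f(n/N)`, where each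
of the `n i` agents of type `i` independently moves to type `j` with probability `P i j`,
the sum running over all arrays `ξ ∈ ℤ₊^{r×r}` whose `i`-th row sums to `n i`. -/
def SOp {r : ℕ} (N : ℕ) (P : Matrix (Fin r) (Fin r) ℝ) (f : (Fin r → ℝ) → ℝ)
    (n : Fin r → ℕ) : ℝ :=
  ∑ ξ ∈ Fintype.piFinset fun i => Finset.Nat.antidiagonalTuple r (n i),
    (∏ i, multinomialWeight (P i) (ξ i)) * f fun j => ((∑ i, ξ i j : ℕ) : ℝ) / N

/-- The multinomial-sampling operator `T_N f(p) = E[f(M/N)]`, `M ~ multinomial(N,p)`. -/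
def TOp {r : ℕ} (N : ℕ) (f : (Fin r → ℝ) → ℝ) (p : Fin r → ℝ) : ℝ :=
  ∑ α ∈ Finset.Nat.antidiagonalTuple r N,
    multinomialWeight p α * f fun i => (α i : ℝ) / N

/-- One-step operator of internal dynamics followed by multinomial sampling:
`U_{N,k} f = S_{N,k}(T_N f)`. -/
def UOp {r : ℕ} (N : ℕ) (P : Matrix (Fin r) (Fin r) ℝ) (f : (Fin r → ℝ) → ℝ)
    (n : Fin r → ℕ) : ℝ :=
  SOp N P (TOp N f) n

/-- The first-order generator `G_A(t) f(p) = ∑_{i,j} pᵢ aᵢⱼ(t) ∂f/∂xⱼ(p)`,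
here taking the matrix `A(t)` as argument. -/
def GA {r : ℕ} (M : Matrix (Fin r) (Fin r) ℝ) (f : (Fin r → ℝ) → ℝ) (p : Fin r → ℝ) : ℝ :=
  ∑ i, ∑ j, p i * M i j * fderiv ℝ f p (Pi.single j 1)

/-- The Wright–Fisher generator
`G_B f(p) = (1/2) ∑_{i,j} pᵢ(δᵢⱼ − pⱼ) ∂²f/∂xᵢ∂xⱼ(p)`. -/
def GB {r : ℕ} (f : (Fin r → ℝ) → ℝ) (p : Fin r → ℝ) : ℝ :=
  (1 / 2) * ∑ i, ∑ j,
    p i * ((if i = j then (1 : ℝ) else 0) - p j) *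
      fderiv ℝ (fun x => fderiv ℝ f x (Pi.single j 1)) p (Pi.single i 1)


section ProductExpectation

variable {ι β : Type*} [Fintype ι] [DecidableEq ι] {s : ι → Finset β} {w : ι → β → ℝ}

/-- Under a product weight, the sum of a product of functions of the coordinates factorizes. -/
theorem sum_piFinset_prod_mul_prod (s : ι → Finset β) (w g : ι → β → ℝ) :
    ∑ ξ ∈ Fintype.piFinset s, (∏ l, w l (ξ l)) * ∏ l, g l (ξ l)
      = ∏ l, ∑ b ∈ s l, w l b * g l b := by
  rw [Finset.prod_univ_sum]
  simp only [Finset.prod_mul_distrib]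

theorem sum_piFinset_prod_eq_one (hw : ∀ i, ∑ b ∈ s i, w i b = 1) :
    ∑ ξ ∈ Fintype.piFinset s, ∏ l, w l (ξ l) = 1 := by
  rw [← Finset.prod_univ_sum]
  simp [hw]

/-- The expectation of a function of one coordinate is that under the marginal weight. -/
theorem sum_piFinset_prod_mul_apply (hw : ∀ i, ∑ b ∈ s i, w i b = 1) (i : ι) (h : β → ℝ) :
    ∑ ξ ∈ Fintype.piFinset s, (∏ l, w l (ξ l)) * h (ξ i) = ∑ b ∈ s i, w i b * h b := by
  have := sum_piFinset_prod_mul_prod s w (fun l b => if l = i then h b else 1)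
  simp only [Finset.prod_ite_eq', Finset.mem_univ, if_true] at this
  rw [this, Finset.prod_eq_single i]
  · simp
  · intro l _ hl
    simp [hl, hw]
  · simp

/-- Distinct coordinates are independent under a product weight. -/
theorem sum_piFinset_prod_mul_apply_mul_apply (hw : ∀ i, ∑ b ∈ s i, w i b = 1) {i k : ι}
    (hik : i ≠ k) (h g : β → ℝ) :
    ∑ ξ ∈ Fintype.piFinset s, (∏ l, w l (ξ l)) * (h (ξ i) * g (ξ k))
      = (∑ b ∈ s i, w i b * h b) * ∑ b ∈ s k, w k b * g b := by
  have := sum_piFinset_prod_mul_prod s w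
    (fun l b => (if l = i then h b else 1) * (if l = k then g b else 1))
  simp only [Finset.prod_mul_distrib, Finset.prod_ite_eq', Finset.mem_univ, if_true] at this
  rw [this, Finset.prod_eq_mul i k hik]
  · simp [hik, hik.symm]
  · intro l _ hl
    simp [hl.1, hl.2, hw]
  · simp
  · simp

/-- The second moment of a shifted sum of independent centred variables. -/
theorem sum_piFinset_prod_mul_sum_add_sq (hw : ∀ i, ∑ b ∈ s i, w i b = 1) (x : ι → β → ℝ)
    (hx : ∀ i, ∑ b ∈ s i, w i b * x i b = 0) (m : ℝ) :
    ∑ ξ ∈ Fintype.piFinset s, (∏ l, w l (ξ l)) * (∑ i, x i (ξ i) + m) ^ 2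
      = ∑ i, ∑ b ∈ s i, w i b * x i b ^ 2 + m ^ 2 := by
  have hexp : ∀ ξ : ι → β, (∏ l, w l (ξ l)) * (∑ i, x i (ξ i) + m) ^ 2
      = ∑ i, ∑ k, (∏ l, w l (ξ l)) * (x i (ξ i) * x k (ξ k))
        + 2 * m * ∑ i, (∏ l, w l (ξ l)) * x i (ξ i) + m ^ 2 * ∏ l, w l (ξ l) := by
    intro ξ
    simp only [← Finset.mul_sum, ← Finset.sum_mul]
    ring
  have hcross : ∀ i k, ∑ ξ ∈ Fintype.piFinset s, (∏ l, w l (ξ l)) * (x i (ξ i) * x k (ξ k))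
      = if i = k then ∑ b ∈ s i, w i b * x i b ^ 2 else 0 := by
    intro i k
    split_ifs with hik
    · subst hik
      rw [sum_piFinset_prod_mul_apply hw i (fun b => x i b * x i b)]
      simp only [sq]
    · rw [sum_piFinset_prod_mul_apply_mul_apply hw hik, hx, zero_mul]
  have hsum : ∑ ξ ∈ Fintype.piFinset s, ∑ i, ∑ k, (∏ l, w l (ξ l)) * (x i (ξ i) * x k (ξ k))
      = ∑ i, ∑ b ∈ s i, w i b * x i b ^ 2 := by
    rw [Finset.sum_comm]
    refine Finset.sum_congr rfl fun i _ => ?_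
    rw [Finset.sum_comm]
    simp [hcross]
  have hlin : ∑ ξ ∈ Fintype.piFinset s, ∑ i, (∏ l, w l (ξ l)) * x i (ξ i) = 0 := by
    rw [Finset.sum_comm]
    exact Finset.sum_eq_zero fun i _ => by rw [sum_piFinset_prod_mul_apply hw, hx]
  rw [Finset.sum_congr rfl fun ξ _ => hexp ξ, Finset.sum_add_distrib, Finset.sum_add_distrib,
    ← Finset.mul_sum, ← Finset.mul_sum, hsum, hlin, sum_piFinset_prod_eq_one hw]
  ring

end ProductExpectation

section Multinomial

open Polynomial

variable {r : ℕ} {p : Fin r → ℝ}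

theorem antidiagonalTuple_eq_piAntidiag (r n : ℕ) :
    Finset.Nat.antidiagonalTuple r n = Finset.piAntidiag Finset.univ n := by
  ext β
  simp [Finset.Nat.mem_antidiagonalTuple]

theorem multinomialWeight_nonneg (hp : ∀ j, 0 ≤ p j) (β : Fin r → ℕ) :
    0 ≤ multinomialWeight p β :=
  mul_nonneg (Nat.cast_nonneg _) (Finset.prod_nonneg fun j _ => pow_nonneg (hp j) _)

/-- The probability generating function of one coordinate of a multinomial vector. -/
theorem sum_multinomialWeight_mul_X_pow (hp : ∑ j, p j = 1) (n : ℕ) (j : Fin r) :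
    ∑ β ∈ Finset.Nat.antidiagonalTuple r n, C (multinomialWeight p β) * X ^ β j
      = (C (1 - p j) + C (p j) * X) ^ n := by
  have hsum : ∑ i, C (p i) * (if i = j then X else 1) = C (1 - p j) + C (p j) * X := by
    rw [← hp, ← Finset.add_sum_erase _ _ (Finset.mem_univ j),
      ← Finset.add_sum_erase _ p (Finset.mem_univ j)]
    have : ∑ i ∈ Finset.univ.erase j, C (p i) * (if i = j then X else 1)
        = C (∑ i ∈ Finset.univ.erase j, p i) := by
      rw [map_sum]
      exact Finset.sum_congr rfl fun i hi => by simp [Finset.ne_of_mem_erase hi]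
    rw [this]
    simp
    ring
  rw [← hsum, Finset.sum_pow_eq_sum_piAntidiag, antidiagonalTuple_eq_piAntidiag]
  refine Finset.sum_congr rfl fun β _ => ?_
  simp only [multinomialWeight, mul_pow, Finset.prod_mul_distrib, ite_pow, one_pow,
    Finset.prod_ite_eq', Finset.mem_univ, if_true, map_mul, map_prod, map_pow, map_natCast]
  ring

theorem sum_multinomialWeight (hp : ∑ j, p j = 1) (n : ℕ) :
    ∑ β ∈ Finset.Nat.antidiagonalTuple r n, multinomialWeight p β = 1 := by
  simp only [multinomialWeight]
  rw [antidiagonalTuple_eq_piAntidiag, ← Finset.sum_pow_eq_sum_piAntidiag, hp, one_pow]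

theorem sum_multinomialWeight_mul_apply (hp : ∑ j, p j = 1) (n : ℕ) (j : Fin r) :
    ∑ β ∈ Finset.Nat.antidiagonalTuple r n, multinomialWeight p β * β j = n * p j := by
  have h := congrArg (fun q => (derivative q).eval 1) (sum_multinomialWeight_mul_X_pow hp n j)
  simpa [derivative_pow, eval_finsetSum] using h

theorem sum_multinomialWeight_mul_apply_mul_pred (hp : ∑ j, p j = 1) (n : ℕ) (j : Fin r) :
    ∑ β ∈ Finset.Nat.antidiagonalTuple r n, multinomialWeight p β * (β j * (β j - 1))
      = n * (n - 1) * p j ^ 2 := by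
  have hcast : ∀ m : ℕ, (m : ℝ) * ((m - 1 : ℕ) : ℝ) = m * (m - 1) := by
    rintro (_ | m) <;> simp
  have h := congrArg (fun q => (derivative (derivative q)).eval 1)
    (sum_multinomialWeight_mul_X_pow hp n j)
  simp [derivative_pow, eval_finsetSum, hcast] at h
  rw [h, ← hcast]
  ring

/-- Coordinates of a multinomial vector have binomial variance. -/
theorem sum_multinomialWeight_mul_sub_sq (hp : ∑ j, p j = 1) (n : ℕ) (j : Fin r) :
    ∑ β ∈ Finset.Nat.antidiagonalTuple r n, multinomialWeight p β * ((β j : ℝ) - n * p j) ^ 2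
      = n * (p j * (1 - p j)) := by
  have hexp : ∀ β : Fin r → ℕ, multinomialWeight p β * ((β j : ℝ) - n * p j) ^ 2
      = multinomialWeight p β * (β j * (β j - 1))
        + (1 - 2 * (n * p j)) * (multinomialWeight p β * β j)
        + (n * p j) ^ 2 * multinomialWeight p β := fun β => by ring
  simp only [hexp, Finset.sum_add_distrib, ← Finset.mul_sum]
  rw [sum_multinomialWeight_mul_apply_mul_pred hp, sum_multinomialWeight_mul_apply hp,
    sum_multinomialWeight hp]
  ring

theorem sum_multinomialWeight_mul_sub (hp : ∑ j, p j = 1) (n : ℕ) (j : Fin r) :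
    ∑ β ∈ Finset.Nat.antidiagonalTuple r n, multinomialWeight p β * ((β j : ℝ) - n * p j) = 0 := by
  simp only [mul_sub, Finset.sum_sub_distrib, ← Finset.sum_mul]
  rw [sum_multinomialWeight_mul_apply hp, sum_multinomialWeight hp]
  ring

end Multinomial

section UniformMetric

variable {r : ℕ}

theorem abs_apply_le_frobNorm (M : Matrix (Fin r) (Fin r) ℝ) (i j : Fin r) :
    |M i j| ≤ frobNorm M := by
  refine Real.abs_le_sqrt ?_
  calc M i j ^ 2 ≤ ∑ l, M i l ^ 2 :=
        Finset.single_le_sum (f := fun l => M i l ^ 2) (fun l _ => sq_nonneg _) (Finset.mem_univ j)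
    _ ≤ _ := Finset.single_le_sum (f := fun k => ∑ l, M k l ^ 2)
        (fun k _ => Finset.sum_nonneg fun l _ => sq_nonneg _) (Finset.mem_univ i)

theorem frobNorm_nonneg (M : Matrix (Fin r) (Fin r) ℝ) : 0 ≤ frobNorm M := Real.sqrt_nonneg _

variable (x y : ℝ → Matrix (Fin r) (Fin r) ℝ)

theorem bddAbove_truncated_distance (u : ℝ) :
    BddAbove ((fun t => min (frobNorm (x t - y t)) 1) '' Set.Icc 0 u) :=
  ⟨1, by rintro _ ⟨t, _, rfl⟩; exact min_le_right _ _⟩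

theorem sSup_truncated_distance_nonneg (u : ℝ) :
    0 ≤ sSup ((fun t => min (frobNorm (x t - y t)) 1) '' Set.Icc 0 u) :=
  Real.sSup_nonneg (by rintro _ ⟨t, _, rfl⟩; exact le_min (frobNorm_nonneg _) zero_le_one)

theorem sSup_truncated_distance_le_one (u : ℝ) :
    sSup ((fun t => min (frobNorm (x t - y t)) 1) '' Set.Icc 0 u) ≤ 1 :=
  Real.sSup_le (by rintro _ ⟨t, _, rfl⟩; exact min_le_right _ _) zero_le_one

theorem monotone_sSup_truncated_distance :
    Monotone fun u => sSup ((fun t => min (frobNorm (x t - y t)) 1) '' Set.Icc 0 u) := by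
  intro u v huv
  refine Real.sSup_le ?_ (sSup_truncated_distance_nonneg x y v)
  rintro _ ⟨t, ht, rfl⟩
  exact le_csSup (bddAbove_truncated_distance x y v) ⟨t, ⟨ht.1, ht.2.trans huv⟩, rfl⟩

/-- The metric `dU` controls the truncated distance uniformly on compact time intervals. -/
theorem exp_mul_min_frobNorm_le_dU {t T : ℝ} (ht : 0 ≤ t) (htT : t ≤ T) :
    Real.exp (-T) * min (frobNorm (x t - y t)) 1 ≤ dU x y := by
  have hT : 0 ≤ T := ht.trans htT
  set S : ℝ → ℝ := fun u => sSup ((fun t => min (frobNorm (x t - y t)) 1) '' Set.Icc 0 u)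
  have hint : IntegrableOn (fun u => Real.exp (-u) * S u) (Set.Ioi 0) := by
    refine Integrable.mono' (integrableOn_exp_neg_Ioi 0) ?_ ?_
    · exact ((Real.measurable_exp.comp measurable_neg).mul
        (monotone_sSup_truncated_distance x y).measurable).aestronglyMeasurable
    · refine Filter.Eventually.of_forall fun u => ?_
      rw [Real.norm_of_nonneg (mul_nonneg (Real.exp_pos _).le
        (sSup_truncated_distance_nonneg x y u))]
      exact mul_le_of_le_one_right (Real.exp_pos _).le (sSup_truncated_distance_le_one x y u)
  have hsub : Set.Ioi T ⊆ Set.Ioi (0 : ℝ) := Set.Ioi_subset_Ioi hT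
  calc Real.exp (-T) * min (frobNorm (x t - y t)) 1
      = ∫ u in Set.Ioi T, Real.exp (-u) * min (frobNorm (x t - y t)) 1 := by
        rw [integral_mul_const, integral_exp_neg_Ioi]
    _ ≤ ∫ u in Set.Ioi T, Real.exp (-u) * S u := by
        refine setIntegral_mono_on ((integrableOn_exp_neg_Ioi T).mul_const _)
          (hint.mono_set hsub) measurableSet_Ioi fun u hu => ?_
        refine mul_le_mul_of_nonneg_left ?_ (Real.exp_pos _).le
        exact le_csSup (bddAbove_truncated_distance x y u) ⟨t, ⟨ht, htT.trans (le_of_lt hu)⟩, rfl⟩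
    _ ≤ ∫ u in Set.Ioi 0, Real.exp (-u) * S u := by
        refine setIntegral_mono_set hint (Filter.Eventually.of_forall fun u => ?_)
          (Filter.Eventually.of_forall hsub)
        exact mul_nonneg (Real.exp_pos _).le (sSup_truncated_distance_nonneg x y u)
    _ = dU x y := rfl

/-- Convergence in `dU` implies entrywise convergence, uniformly on compact time intervals. -/
theorem exists_forall_abs_sub_lt_of_tendsto_dU {A : ℕ → ℝ → Matrix (Fin r) (Fin r) ℝ}
    (hconv : Filter.Tendsto (fun N => dU (A N) y) Filter.atTop (nhds 0)) (T : ℝ) {δ : ℝ}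
    (hδ : 0 < δ) :
    ∃ N₀ : ℕ, ∀ N, N₀ ≤ N → ∀ t, 0 ≤ t → t ≤ T → ∀ i j, |A N t i j - y t i j| < δ := by
  have hpos : 0 < Real.exp (-T) * min δ 1 := mul_pos (Real.exp_pos _) (lt_min hδ one_pos)
  obtain ⟨N₀, h⟩ := Filter.eventually_atTop.1 (hconv.eventually_lt_const hpos)
  refine ⟨N₀, fun N hN t ht htT i j => ?_⟩
  have hlt := lt_of_mul_lt_mul_left
    ((exp_mul_min_frobNorm_le_dU (A N) y ht htT).trans_lt (h N hN)) (Real.exp_pos _).le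
  refine (abs_apply_le_frobNorm (A N t - y t) i j).trans_lt ?_
  have h1 : frobNorm (A N t - y t) < 1 := by
    by_contra! hge
    rw [min_eq_right hge] at hlt
    exact (hlt.trans_le (min_le_right _ _)).false
  rw [min_eq_left h1.le] at hlt
  exact hlt.trans_le (min_le_left _ _)

end UniformMetric

section Taylor

/-- A first-order Taylor estimate with quadratic remainder, uniform on a compact convex set. -/
theorem exists_taylor_bound_of_contDiff_two {E : Type*} [NormedAddCommGroup E] [NormedSpace ℝ E]
    {f : E → ℝ} (hf : ContDiff ℝ 2 f) {K : Set E} (hK : IsCompact K) (hconv : Convex ℝ K) :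
    ∃ L, 0 ≤ L ∧ ∀ p ∈ K, ∀ q ∈ K, |f q - f p - fderiv ℝ f p (q - p)| ≤ L * ‖q - p‖ ^ 2 := by
  have hf' : ContDiff ℝ 1 (fderiv ℝ f) := hf.fderiv_right (by norm_num)
  obtain ⟨L, hL⟩ := hK.exists_bound_of_continuousOn
    (hf'.continuous_fderiv (by norm_num)).continuousOn
  refine ⟨|L|, abs_nonneg L, fun p hp q hq => ?_⟩
  have hseg : segment ℝ p q ⊆ K := hconv.segment_subset hp hq
  have hbound : ∀ z ∈ segment ℝ p q, ‖fderiv ℝ f z - fderiv ℝ f p‖ ≤ |L| * ‖q - p‖ := by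
    intro z hz
    calc ‖fderiv ℝ f z - fderiv ℝ f p‖ ≤ |L| * ‖z - p‖ :=
          hconv.norm_image_sub_le_of_norm_fderiv_le
            (fun w _ => (hf'.differentiable (by norm_num)).differentiableAt)
            (fun w hw => (hL w hw).trans (le_abs_self L)) hp (hseg hz)
      _ ≤ |L| * ‖q - p‖ := by
          gcongr
          obtain ⟨θ, hθ, rfl⟩ := (segment_eq_image' ℝ p q) ▸ hz
          rw [add_sub_cancel_left, norm_smul, Real.norm_of_nonneg hθ.1]
          exact mul_le_of_le_one_left (norm_nonneg _) hθ.2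
  have := (convex_segment p q).norm_image_sub_le_of_norm_hasFDerivWithin_le'
    (fun z _ => ((hf.differentiable (by norm_num)) z).hasFDerivAt.hasFDerivWithinAt) hbound
    (left_mem_segment ℝ p q) (right_mem_segment ℝ p q)
  rw [Real.norm_eq_abs] at this
  linarith [this, show |L| * ‖q - p‖ * ‖q - p‖ = |L| * ‖q - p‖ ^ 2 by ring]

theorem norm_sq_le_sum_sq {r : ℕ} (v : Fin r → ℝ) : ‖v‖ ^ 2 ≤ ∑ j, v j ^ 2 := by
  have hnn : 0 ≤ ∑ j, v j ^ 2 := Finset.sum_nonneg fun j _ => sq_nonneg _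
  rw [← Real.sqrt_le_sqrt_iff hnn, Real.sqrt_sq (norm_nonneg v)]
  refine (pi_norm_le_iff_of_nonneg (Real.sqrt_nonneg _)).2 fun j => ?_
  exact Real.abs_le_sqrt (Finset.single_le_sum (f := fun l => v l ^ 2)
    (fun l _ => sq_nonneg _) (Finset.mem_univ j))

theorem fderiv_apply_eq_sum_single {r : ℕ} (φ : (Fin r → ℝ) →L[ℝ] ℝ) (v : Fin r → ℝ) :
    φ v = ∑ j, v j * φ (Pi.single j 1) := by
  conv_lhs => rw [pi_eq_sum_univ' v]
  simp [map_sum]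

end Taylor

section Transition

variable {r N : ℕ} {P : Matrix (Fin r) (Fin r) ℝ}

theorem sum_transition_weight (hP : IsStochastic P) (n : Fin r → ℕ) :
    ∑ ξ ∈ Fintype.piFinset fun i => Finset.Nat.antidiagonalTuple r (n i),
      ∏ i, multinomialWeight (P i) (ξ i) = 1 :=
  sum_piFinset_prod_eq_one fun i => sum_multinomialWeight (hP.2 i) (n i)

/-- The mean displacement of the proportion of agents of type `j`. -/
theorem sum_transition_weight_mul_sub (hP : IsStochastic P) (n : Fin r → ℕ) (j : Fin r) :
    ∑ ξ ∈ Fintype.piFinset fun i => Finset.Nat.antidiagonalTuple r (n i),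
      (∏ i, multinomialWeight (P i) (ξ i)) * (((∑ i, ξ i j : ℕ) : ℝ) / N - n j / N)
      = (∑ i, n i * P i j - n j) / N := by
  have hw := fun i => sum_multinomialWeight (hP.2 i) (n i)
  have hexp : ∀ ξ : Fin r → Fin r → ℕ,
      (∏ i, multinomialWeight (P i) (ξ i)) * (((∑ i, ξ i j : ℕ) : ℝ) / N - n j / N)
      = ((∑ i, (∏ l, multinomialWeight (P l) (ξ l)) * (ξ i j : ℝ))
          - (∏ l, multinomialWeight (P l) (ξ l)) * n j) / N := by
    intro ξ
    rw [← Finset.mul_sum]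
    push_cast
    ring
  rw [Finset.sum_congr rfl fun ξ _ => hexp ξ, ← Finset.sum_div, Finset.sum_sub_distrib,
    ← Finset.sum_mul, sum_transition_weight hP, Finset.sum_comm, one_mul]
  congr 2
  refine Finset.sum_congr rfl fun i _ => ?_
  rw [sum_piFinset_prod_mul_apply hw i (fun β => (β j : ℝ)),
    sum_multinomialWeight_mul_apply (hP.2 i)]

/-- The mean square displacement of the proportion of agents of type `j`. -/
theorem sum_transition_weight_mul_sub_sq (hP : IsStochastic P) (n : Fin r → ℕ) (j : Fin r) :
    ∑ ξ ∈ Fintype.piFinset fun i => Finset.Nat.antidiagonalTuple r (n i),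
      (∏ i, multinomialWeight (P i) (ξ i)) * (((∑ i, ξ i j : ℕ) : ℝ) / N - n j / N) ^ 2
      = (∑ i, n i * (P i j * (1 - P i j)) + (∑ i, n i * P i j - n j) ^ 2) / N ^ 2 := by
  have hexp : ∀ ξ : Fin r → Fin r → ℕ,
      (∏ i, multinomialWeight (P i) (ξ i)) * (((∑ i, ξ i j : ℕ) : ℝ) / N - n j / N) ^ 2
      = (∏ i, multinomialWeight (P i) (ξ i))
          * (∑ i, ((ξ i j : ℝ) - n i * P i j) + (∑ i, n i * P i j - n j)) ^ 2 / N ^ 2 := by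
    intro ξ
    rw [Finset.sum_sub_distrib]
    push_cast
    ring
  rw [Finset.sum_congr rfl fun ξ _ => hexp ξ, ← Finset.sum_div,
    sum_piFinset_prod_mul_sum_add_sq (fun i => sum_multinomialWeight (hP.2 i) (n i))
      (fun i β => (β j : ℝ) - n i * P i j)
      (fun i => sum_multinomialWeight_mul_sub (hP.2 i) (n i) j)]
  simp only [fun i => sum_multinomialWeight_mul_sub_sq (hP.2 i) (n i) j]

theorem proportion_mem_Icc {m : Fin r → ℕ} (hm : ∀ i, m i ≤ N) :
    (fun i => (m i : ℝ) / N) ∈ Set.Icc (0 : Fin r → ℝ) 1 :=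
  ⟨fun _ => by dsimp; positivity,
    fun i => div_le_one_of_le₀ (Nat.cast_le.2 (hm i)) (Nat.cast_nonneg N)⟩

variable {a : Matrix (Fin r) (Fin r) ℝ} {n : Fin r → ℕ}

/-- For the step matrix `1 + a / N`, the mean drift is governed by `a`. -/
theorem sum_mul_one_add_smul_sub (n : Fin r → ℕ) (j : Fin r) :
    ∑ i, n i * (1 + ((N : ℝ))⁻¹ • a) i j - n j = ∑ i, (n i : ℝ) / N * a i j := by
  have h : ∀ i, (n i : ℝ) * (1 + ((N : ℝ))⁻¹ • a) i j
      = (if i = j then (n i : ℝ) else 0) + (n i : ℝ) / N * a i j := by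
    intro i
    simp only [Matrix.add_apply, Matrix.one_apply, Matrix.smul_apply, smul_eq_mul]
    split_ifs <;> ring
  rw [Finset.sum_congr rfl fun i _ => h i, Finset.sum_add_distrib]
  simp

theorem sum_mul_mul_one_sub_le (hN : 1 ≤ N) (hP : IsStochastic (1 + ((N : ℝ))⁻¹ • a))
    {c : ℝ} (ha : ∀ i j, |a i j| ≤ c) (hn : ∑ i, n i = N) (j : Fin r) :
    ∑ i, n i * ((1 + ((N : ℝ))⁻¹ • a) i j * (1 - (1 + ((N : ℝ))⁻¹ • a) i j)) ≤ c := by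
  have hNpos : (0 : ℝ) < N := by exact_mod_cast hN
  have hn' : ∑ i, (n i : ℝ) = N := by exact_mod_cast hn
  have hvar : ∀ i, (1 + ((N : ℝ))⁻¹ • a) i j * (1 - (1 + ((N : ℝ))⁻¹ • a) i j) ≤ c / N := by
    intro i
    have h0 := hP.1 i j
    have h1 : (1 + ((N : ℝ))⁻¹ • a) i j ≤ 1 := by
      rw [← hP.2 i]
      exact Finset.single_le_sum (f := fun l => (1 + ((N : ℝ))⁻¹ • a) i l)
        (fun l _ => hP.1 i l) (Finset.mem_univ j)
    have hval : (1 + ((N : ℝ))⁻¹ • a) i j = (if i = j then 1 else 0) + a i j / N := by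
      simp only [Matrix.add_apply, Matrix.one_apply, Matrix.smul_apply, smul_eq_mul]
      ring
    have hc := abs_le.1 (ha i j)
    have hu : a i j / N ≤ c / N := by gcongr; exact hc.2
    have hl : -(c / N) ≤ a i j / N := by rw [← neg_div]; gcongr; exact hc.1
    set q := (1 + ((N : ℝ))⁻¹ • a) i j
    split_ifs at hval <;> nlinarith
  calc _ ≤ ∑ i, (n i : ℝ) * (c / N) :=
        Finset.sum_le_sum fun i _ => mul_le_mul_of_nonneg_left (hvar i) (Nat.cast_nonneg _)
    _ = c := by
        rw [← Finset.sum_mul, hn']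
        field_simp

theorem abs_sum_proportion_mul_le (hN : 1 ≤ N) {c : ℝ} (ha : ∀ i j, |a i j| ≤ c)
    (hn : ∑ i, n i = N) (j : Fin r) : |∑ i, (n i : ℝ) / N * a i j| ≤ c := by
  have hNpos : (0 : ℝ) < N := by exact_mod_cast hN
  have hn' : ∑ i, (n i : ℝ) = N := by exact_mod_cast hn
  calc _ ≤ ∑ i, |(n i : ℝ) / N * a i j| := Finset.abs_sum_le_sum_abs _ _
    _ ≤ ∑ i, (n i : ℝ) / N * c := by
        refine Finset.sum_le_sum fun i _ => ?_
        have hnonneg : (0 : ℝ) ≤ (n i : ℝ) / N := by positivity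
        rw [abs_mul, abs_of_nonneg hnonneg]
        exact mul_le_mul_of_nonneg_left (ha i j) hnonneg
    _ = c := by
        rw [← Finset.sum_mul, ← Finset.sum_div, hn']
        field_simp

/-- The discrete generator of one step with matrix `1 + a / N` is within `O(1 / N)` of `GA a`. -/
theorem abs_mul_SOp_sub_sub_GA_le {f : (Fin r → ℝ) → ℝ} {L c : ℝ} (hL : 0 ≤ L)
    (hf : ∀ p ∈ Set.Icc (0 : Fin r → ℝ) 1, ∀ q ∈ Set.Icc (0 : Fin r → ℝ) 1,
      |f q - f p - fderiv ℝ f p (q - p)| ≤ L * ‖q - p‖ ^ 2)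
    (hN : 1 ≤ N) (hP : IsStochastic (1 + ((N : ℝ))⁻¹ • a)) (ha : ∀ i j, |a i j| ≤ c)
    (hn : ∑ i, n i = N) :
    |(N : ℝ) * (SOp N (1 + ((N : ℝ))⁻¹ • a) f n - f fun i => (n i : ℝ) / N)
      - GA a f (fun i => (n i : ℝ) / N)| ≤ L * (r * (c + c ^ 2)) / N := by
  have hNpos : (0 : ℝ) < N := by exact_mod_cast hN
  set Q := 1 + ((N : ℝ))⁻¹ • a
  set p : Fin r → ℝ := fun i => (n i : ℝ) / N
  set S := Fintype.piFinset fun i => Finset.Nat.antidiagonalTuple r (n i)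
  set W : (Fin r → Fin r → ℕ) → ℝ := fun ξ => ∏ i, multinomialWeight (Q i) (ξ i)
  set y : (Fin r → Fin r → ℕ) → Fin r → ℝ := fun ξ j => ((∑ i, ξ i j : ℕ) : ℝ) / N
  have hW : ∀ ξ, 0 ≤ W ξ := fun ξ =>
    Finset.prod_nonneg fun i _ => multinomialWeight_nonneg (hP.1 i) (ξ i)
  have hpK : p ∈ Set.Icc (0 : Fin r → ℝ) 1 := proportion_mem_Icc fun i =>
    hn ▸ Finset.single_le_sum (fun _ _ => Nat.zero_le _) (Finset.mem_univ i)
  have hyK : ∀ ξ ∈ S, y ξ ∈ Set.Icc (0 : Fin r → ℝ) 1 := by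
    intro ξ hξ
    refine proportion_mem_Icc fun j => hn ▸ Finset.sum_le_sum fun i _ => ?_
    have hi := Finset.Nat.mem_antidiagonalTuple.1 (Fintype.mem_piFinset.1 hξ i)
    exact hi ▸ Finset.single_le_sum (f := ξ i) (fun _ _ => Nat.zero_le _) (Finset.mem_univ j)
  have hmean : ∀ j, ∑ ξ ∈ S, W ξ * (y ξ j - p j) = (∑ i, p i * a i j) / N := fun j => by
    rw [sum_transition_weight_mul_sub hP n j, sum_mul_one_add_smul_sub]
  have hsq : ∀ j, ∑ ξ ∈ S, W ξ * (y ξ j - p j) ^ 2 ≤ (c + c ^ 2) / N ^ 2 := fun j => by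
    rw [sum_transition_weight_mul_sub_sq hP n j, sum_mul_one_add_smul_sub]
    have hdev := abs_le.1 (abs_sum_proportion_mul_le hN ha hn j)
    exact div_le_div_of_nonneg_right (add_le_add (sum_mul_mul_one_sub_le hN hP ha hn j)
      (sq_le_sq' hdev.1 hdev.2)) (sq_nonneg _)
  have hdrift : ∑ ξ ∈ S, W ξ * fderiv ℝ f p (y ξ - p) = GA a f p / N := by
    have h : ∀ ξ, W ξ * fderiv ℝ f p (y ξ - p)
        = ∑ j, W ξ * (y ξ j - p j) * fderiv ℝ f p (Pi.single j 1) := by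
      intro ξ
      rw [fderiv_apply_eq_sum_single, Finset.mul_sum]
      simp only [Pi.sub_apply, mul_assoc]
    rw [Finset.sum_congr rfl fun ξ _ => h ξ, Finset.sum_comm]
    simp only [← Finset.sum_mul, hmean]
    rw [GA, Finset.sum_comm, Finset.sum_div]
    refine Finset.sum_congr rfl fun j _ => ?_
    rw [← Finset.sum_mul]
    ring
  have hrem : (N : ℝ) * (SOp N Q f n - f p) - GA a f p
      = N * ∑ ξ ∈ S, W ξ * (f (y ξ) - f p - fderiv ℝ f p (y ξ - p)) := by
    have hS : SOp N Q f n = ∑ ξ ∈ S, W ξ * f (y ξ) := rfl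
    have hone : ∑ ξ ∈ S, W ξ = 1 := sum_transition_weight hP n
    simp only [mul_sub, Finset.sum_sub_distrib]
    rw [hdrift, ← Finset.sum_mul, hone, hS]
    field_simp
  rw [hrem, abs_mul, abs_of_pos hNpos]
  calc (N : ℝ) * |∑ ξ ∈ S, W ξ * (f (y ξ) - f p - fderiv ℝ f p (y ξ - p))|
      ≤ N * ∑ ξ ∈ S, L * ∑ j, W ξ * (y ξ j - p j) ^ 2 := by
        gcongr
        refine (Finset.abs_sum_le_sum_abs _ _).trans (Finset.sum_le_sum fun ξ hξ => ?_)
        rw [abs_mul, abs_of_nonneg (hW ξ), ← Finset.mul_sum, mul_left_comm]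
        refine mul_le_mul_of_nonneg_left ?_ (hW ξ)
        exact (hf p hpK _ (hyK ξ hξ)).trans
          (mul_le_mul_of_nonneg_left (norm_sq_le_sum_sq (y ξ - p)) hL)
    _ = N * (L * ∑ j, ∑ ξ ∈ S, W ξ * (y ξ j - p j) ^ 2) := by
        rw [← Finset.mul_sum, Finset.sum_comm]
    _ ≤ N * (L * ∑ _j : Fin r, (c + c ^ 2) / N ^ 2) := by
        gcongr with j
        exact hsq j
    _ = L * (r * (c + c ^ 2)) / N := by
        simp only [Finset.sum_const, Finset.card_univ, Fintype.card_fin, nsmul_eq_mul]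
        field_simp

theorem abs_GA_sub_GA_le {f : (Fin r → ℝ) → ℝ} {p : Fin r → ℝ} {b : Matrix (Fin r) (Fin r) ℝ}
    {δ D : ℝ} (hδ : 0 ≤ δ) (hp : p ∈ Set.Icc (0 : Fin r → ℝ) 1)
    (hD : ∀ j, |fderiv ℝ f p (Pi.single j 1)| ≤ D) (hab : ∀ i j, |a i j - b i j| ≤ δ) :
    |GA a f p - GA b f p| ≤ r ^ 2 * (δ * D) := by
  have hterm : GA a f p - GA b f p
      = ∑ i, ∑ j, p i * (a i j - b i j) * fderiv ℝ f p (Pi.single j 1) := by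
    simp only [GA, ← Finset.sum_sub_distrib]
    exact Finset.sum_congr rfl fun i _ => Finset.sum_congr rfl fun j _ => by ring
  rw [hterm]
  calc _ ≤ ∑ i, ∑ j, |p i * (a i j - b i j) * fderiv ℝ f p (Pi.single j 1)| :=
        (Finset.abs_sum_le_sum_abs _ _).trans
          (Finset.sum_le_sum fun i _ => Finset.abs_sum_le_sum_abs _ _)
    _ ≤ ∑ _i : Fin r, ∑ _j : Fin r, δ * D := by
        refine Finset.sum_le_sum fun i _ => Finset.sum_le_sum fun j _ => ?_
        rw [abs_mul, abs_mul, abs_of_nonneg (hp.1 i)]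
        refine mul_le_mul ?_ (hD j) (abs_nonneg _) hδ
        exact (mul_le_of_le_one_left (abs_nonneg _) (hp.2 i)).trans (hab i j)
    _ = r ^ 2 * (δ * D) := by
        simp only [Finset.sum_const, Finset.card_univ, Fintype.card_fin, nsmul_eq_mul]
        ring

end Transition

/-- A path constant on the cells `[k / N, (k + 1) / N)` equals its value at the left end of the
cell containing `t`. -/
theorem eq_apply_floor_div_of_stepwise {α : Type*} {N : ℕ} (hN : 1 ≤ N) {x : ℝ → α}
    (hx : ∀ k : ℕ, ∀ t : ℝ, (k : ℝ) / N ≤ t → t < ((k : ℝ) + 1) / N → x t = x ((k : ℝ) / N))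
    {t : ℝ} (ht : 0 ≤ t) : x t = x ((⌊(N : ℝ) * t⌋₊ : ℝ) / N) := by
  have hNpos : (0 : ℝ) < N := by exact_mod_cast hN
  refine hx _ t ?_ ?_
  · rw [div_le_iff₀ hNpos, mul_comm]
    exact Nat.floor_le (by positivity)
  · rw [lt_div_iff₀ hNpos, mul_comm]
    exact Nat.lt_floor_add_one _

/-- A matrix path that is constant on the cells `[k / N, (k + 1) / N)` is bounded on `[0, T]`. -/
theorem exists_bound_of_stepwise {r N : ℕ} (hN : 1 ≤ N) {x : ℝ → Matrix (Fin r) (Fin r) ℝ}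
    (hx : ∀ k : ℕ, ∀ t : ℝ, (k : ℝ) / N ≤ t → t < ((k : ℝ) + 1) / N → x t = x ((k : ℝ) / N))
    (T : ℝ) : ∃ c, ∀ t, 0 ≤ t → t ≤ T → ∀ i j, |x t i j| ≤ c := by
  refine ⟨∑ k ∈ Finset.range (⌊(N : ℝ) * T⌋₊ + 1), frobNorm (x ((k : ℝ) / N)),
    fun t ht htT i j => ?_⟩
  rw [eq_apply_floor_div_of_stepwise hN hx ht]
  refine (abs_apply_le_frobNorm _ i j).trans
    (Finset.single_le_sum (f := fun k : ℕ => frobNorm (x ((k : ℝ) / N)))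
      (fun k _ => frobNorm_nonneg _) ?_)
  rw [Finset.mem_range, Nat.lt_succ_iff]
  exact Nat.floor_mono (by gcongr)

/-- Uniform generator convergence for the internal dynamics: for every C² function `f`
and every `T > 0`,
`lim_N sup_(0≤t≤T) sup_(p ∈ K_N) |N(S_(N,[Nt])f(p) − f(p)) − G_A(t)f(p)| = 0`. -/
theorem internal_dynamics_generator_convergence
    (r : ℕ) (hr : 2 ≤ r)
    (A : ℕ → ℝ → Matrix (Fin r) (Fin r) ℝ)
    (Alim : ℝ → Matrix (Fin r) (Fin r) ℝ)
    (hQ : ∀ N : ℕ, 1 ≤ N → ∀ t : ℝ, 0 ≤ t → IsQMatrix (A N t))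
    (hstepwise : ∀ N : ℕ, 1 ≤ N → ∀ k : ℕ, ∀ t : ℝ,
      (k : ℝ) / N ≤ t → t < ((k : ℝ) + 1) / N → A N t = A N ((k : ℝ) / N))
    (hQlim : ∀ t : ℝ, 0 ≤ t → IsQMatrix (Alim t))
    (hcadlag_right : ∀ t : ℝ, 0 ≤ t → ContinuousWithinAt Alim (Set.Ici t) t)
    (hcadlag_left : ∀ t : ℝ, 0 < t →
      ∃ L, Filter.Tendsto Alim (nhdsWithin t (Set.Iio t)) (nhds L))
    (hstoch : ∀ N : ℕ, 1 ≤ N → ∀ k : ℕ,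
      IsStochastic (1 + ((N : ℝ))⁻¹ • A N ((k : ℝ) / N)))
    (hconv : Filter.Tendsto (fun N => dU (A N) Alim) Filter.atTop (nhds 0))
    (f : (Fin r → ℝ) → ℝ) (hf : ContDiff ℝ 2 f) (T : ℝ) (hT : 0 < T) :
    ∀ ε > 0, ∃ N₀ : ℕ, ∀ N : ℕ, N₀ ≤ N → 1 ≤ N → ∀ t : ℝ, 0 ≤ t → t ≤ T →
      ∀ n : Fin r → ℕ, ∑ i, n i = N →
        |(N : ℝ) * (SOp N (1 + ((N : ℝ))⁻¹ • A N ((⌊(N : ℝ) * t⌋₊ : ℝ) / N)) f n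
              - f fun i => (n i : ℝ) / N)
          - GA (Alim t) f (fun i => (n i : ℝ) / N)| < ε := by
  intro ε hε
  have hKc : IsCompact (Set.Icc (0 : Fin r → ℝ) 1) := isCompact_Icc
  obtain ⟨L, hL, hTaylor⟩ := exists_taylor_bound_of_contDiff_two hf hKc (convex_Icc _ _)
  obtain ⟨D, hD⟩ := hKc.exists_bound_of_continuousOn
    (hf.continuous_fderiv (by norm_num)).continuousOn
  obtain ⟨N₁, hN₁⟩ := exists_forall_abs_sub_lt_of_tendsto_dU Alim hconv T one_pos
  obtain ⟨c₀, hc₀⟩ := exists_bound_of_stepwise (N := N₁ + 1) (by simp)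
    (hstepwise (N₁ + 1) (by simp)) T
  have hbound : ∀ N, N₁ ≤ N → ∀ t, 0 ≤ t → t ≤ T → ∀ i j, |A N t i j| ≤ c₀ + 2 := by
    intro N hN t ht htT i j
    have h1 := abs_lt.1 (hN₁ N hN t ht htT i j)
    have h2 := abs_lt.1 (hN₁ (N₁ + 1) (by simp) t ht htT i j)
    have h3 := abs_le.1 (hc₀ t ht htT i j)
    exact abs_le.2 ⟨by linarith [h1.1, h2.2, h3.1], by linarith [h1.2, h2.1, h3.2]⟩
  have hpos : 0 < (r : ℝ) ^ 2 * |D| + 1 := by positivity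
  obtain ⟨N₂, hN₂⟩ := exists_forall_abs_sub_lt_of_tendsto_dU Alim hconv T
    (div_pos (half_pos hε) hpos)
  obtain ⟨N₃, hN₃⟩ := Filter.eventually_atTop.1
    ((tendsto_const_div_atTop_nhds_zero_nat (L * (r * ((c₀ + 2) + (c₀ + 2) ^ 2)))).eventually_lt_const
      (half_pos hε))
  refine ⟨max N₁ (max N₂ N₃), fun N hN hN1 t ht htT n hn => ?_⟩
  obtain ⟨hNN₁, hNN₂, hNN₃⟩ : N₁ ≤ N ∧ N₂ ≤ N ∧ N₃ ≤ N := by simpa using hN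
  have hstep := eq_apply_floor_div_of_stepwise hN1 (hstepwise N hN1) ht
  have hP := hstoch N hN1 ⌊(N : ℝ) * t⌋₊
  rw [← hstep] at hP ⊢
  have hpK : (fun i => (n i : ℝ) / N) ∈ Set.Icc (0 : Fin r → ℝ) 1 := proportion_mem_Icc fun i =>
    hn ▸ Finset.single_le_sum (fun _ _ => Nat.zero_le _) (Finset.mem_univ i)
  have hDj : ∀ j, |fderiv ℝ f (fun i => (n i : ℝ) / N) (Pi.single j 1)| ≤ |D| := by
    intro j
    refine ((fderiv ℝ f _).le_opNorm _).trans ?_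
    rw [Pi.norm_single, norm_one, mul_one]
    exact (hD _ hpK).trans (le_abs_self D)
  have hdiscr := (abs_mul_SOp_sub_sub_GA_le hL hTaylor hN1 hP (hbound N hNN₁ t ht htT) hn).trans_lt
    (hN₃ N hNN₃)
  have hgen := abs_GA_sub_GA_le (div_pos (half_pos hε) hpos).le hpK hDj
    fun i j => (hN₂ N hNN₂ t ht htT i j).le
  have hsmall : (r : ℝ) ^ 2 * (ε / 2 / ((r : ℝ) ^ 2 * |D| + 1) * |D|) ≤ ε / 2 := by
    rw [show (r : ℝ) ^ 2 * (ε / 2 / ((r : ℝ) ^ 2 * |D| + 1) * |D|)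
      = ε / 2 * ((r : ℝ) ^ 2 * |D| / ((r : ℝ) ^ 2 * |D| + 1)) by ring]
    exact mul_le_of_le_one_right (half_pos hε).le (div_le_one_of_le₀ (by linarith) hpos.le)
  refine (abs_sub_le _ (GA (A N t) f fun i => (n i : ℝ) / N) _).trans_lt ?_
  linarith
end
end

section
/- Let A be a continuous Q-matrix-valued function on [0,∞) and let Y and Ỹ be K-valued progressively measurable processes (on possibly different filtered probability spaces) each solving the martingale problem for G_AB = G_A + G_B on C³. If Y(0) and Ỹ(0) have the same distribution, then for every t ≥ 0 and every multi-index α ∈ ℤ_+^r, E[ ∏_{i=1}^r Y_i(t)^{α_i} ] = E[ ∏_{i=1}^r Ỹ_i(t)^{α_i} ]; consequently Y(t) and Ỹ(t) have the same distribution for each t ≥ 0. -/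
open scoped BigOperators NNReal
open Finset MeasureTheory

noncomputable section

theorem MvPolynomial.hasFDerivAt_eval {σ : Type*} [Fintype σ] (p : MvPolynomial σ ℝ) (x : σ → ℝ) :
    HasFDerivAt (fun y : σ → ℝ => eval y p)
      (∑ i, eval x (pderiv i p) • ContinuousLinearMap.proj (R := ℝ) (φ := fun _ : σ => ℝ) i) x := by
  classical
  induction p using MvPolynomial.induction_on with
  | C a => simpa using hasFDerivAt_const a x
  | add p q hp hq =>
    simpa [add_smul, Finset.sum_add_distrib] using hp.fun_add hq
  | mul_X p i hp =>
    have hX : HasFDerivAt (fun y : σ → ℝ => y i)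
        (ContinuousLinearMap.proj (R := ℝ) (φ := fun _ : σ => ℝ) i) x :=
      hasFDerivAt_apply i x
    have h := hp.fun_mul hX
    simp only [map_mul, eval_X]
    refine h.congr_fderiv ?_
    ext v
    simp only [Derivation.leibniz, pderiv_X, Pi.single_apply, smul_eq_mul, map_add, map_mul, eval_X,
      add_smul, Finset.sum_add_distrib, add_apply, _root_.sum_apply, smul_apply,
      ContinuousLinearMap.proj_apply, Finset.mul_sum]
    congr 1
    · simp [apply_ite (eval x)]
    · exact Finset.sum_congr rfl fun j _ => by ring

theorem MvPolynomial.fderiv_eval_single {σ : Type*} [Fintype σ] [DecidableEq σ]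
    (p : MvPolynomial σ ℝ) (x : σ → ℝ) (j : σ) :
    fderiv ℝ (fun y : σ → ℝ => eval y p) x (Pi.single j 1) = eval x (pderiv j p) := by
  rw [(hasFDerivAt_eval p x).fderiv]
  simp [Pi.single_apply]

theorem MvPolynomial.contDiff_eval {σ : Type*} [Fintype σ] (p : MvPolynomial σ ℝ)
    (n : WithTop ℕ∞) : ContDiff ℝ n (fun y : σ → ℝ => eval y p) := by
  induction p using MvPolynomial.induction_on with
  | C a => simpa using contDiff_const
  | add p q hp hq => simpa using hp.add hq
  | mul_X p i hp => simpa using hp.mul (contDiff_apply ℝ ℝ i)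

/-- The operator `X i * ∂ⱼ` does not raise the total degree. -/
theorem MvPolynomial.totalDegree_X_mul_pderiv_le {σ R : Type*} [CommSemiring R]
    (p : MvPolynomial σ R) (i j : σ) : (X i * pderiv j p).totalDegree ≤ p.totalDegree := by
  classical
  conv_lhs => rw [p.as_sum, map_sum, Finset.mul_sum]
  refine totalDegree_finsetSum_le fun m hm => ?_
  rw [pderiv_monomial]
  by_cases hj : m j = 0
  · simp [hj]
  · rw [X, monomial_mul]
    refine (totalDegree_monomial_le _ _).trans ?_
    refine le_trans (le_of_eq ?_) (le_totalDegree hm)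
    change Finsupp.degree _ = Finsupp.degree m
    have h : m - Finsupp.single j 1 + Finsupp.single j 1 = m :=
      tsub_add_cancel_of_le (by simpa using Nat.one_le_iff_ne_zero.mpr hj)
    conv_rhs => rw [← h]
    simp [add_comm]

theorem MvPolynomial.totalDegree_pderiv_le_totalDegree {σ R : Type*} [CommSemiring R]
    (p : MvPolynomial σ R) (j : σ) : (pderiv j p).totalDegree ≤ p.totalDegree := by
  classical
  conv_lhs => rw [p.as_sum, map_sum]
  refine totalDegree_finsetSum_le fun m hm => ?_
  rw [pderiv_monomial]
  refine (totalDegree_monomial_le _ _).trans (le_trans ?_ (le_totalDegree hm))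
  change Finsupp.degree _ ≤ Finsupp.degree m
  exact Finsupp.degree_mono tsub_le_self

open MvPolynomial in
/-- The action of `G_A + G_B` on polynomials. -/
def polyGenerator {r : ℕ} (M : Matrix (Fin r) (Fin r) ℝ) (p : MvPolynomial (Fin r) ℝ) :
    MvPolynomial (Fin r) ℝ :=
  ∑ i, ∑ j, M i j • (X i * pderiv j p) +
    (1 / 2 : ℝ) • ∑ i, ∑ j,
      ((if i = j then 1 else 0) - X j) * X i * pderiv i (pderiv j p)

open MvPolynomial in
theorem GA_add_GB_eval {r : ℕ} (M : Matrix (Fin r) (Fin r) ℝ) (p : MvPolynomial (Fin r) ℝ)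
    (x : Fin r → ℝ) :
    GA M (fun y => eval y p) x + GB (fun y => eval y p) x = eval x (polyGenerator M p) := by
  simp only [GA, GB, polyGenerator, fderiv_eval_single, map_add, map_sum, smul_eval, map_mul,
    map_sub, eval_X, apply_ite (eval x), map_one, map_zero]
  congr 1
  · exact Finset.sum_congr rfl fun i _ => Finset.sum_congr rfl fun j _ => by ring
  · congr 1
    exact Finset.sum_congr rfl fun i _ => Finset.sum_congr rfl fun j _ => by ring

open MvPolynomial in
theorem polyGenerator_mem_restrictTotalDegree {r n : ℕ} (M : Matrix (Fin r) (Fin r) ℝ)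
    {p : MvPolynomial (Fin r) ℝ} (hp : p ∈ restrictTotalDegree (Fin r) ℝ n) :
    polyGenerator M p ∈ restrictTotalDegree (Fin r) ℝ n := by
  have hE : ∀ {q : MvPolynomial (Fin r) ℝ} (i j : Fin r), q ∈ restrictTotalDegree (Fin r) ℝ n →
      X i * pderiv j q ∈ restrictTotalDegree (Fin r) ℝ n := fun i j hq => by
    rw [mem_restrictTotalDegree] at hq ⊢
    exact (totalDegree_X_mul_pderiv_le _ i j).trans hq
  have hD : ∀ j : Fin r, pderiv j p ∈ restrictTotalDegree (Fin r) ℝ n := fun j => by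
    rw [mem_restrictTotalDegree] at hp ⊢
    exact (totalDegree_pderiv_le_totalDegree p j).trans hp
  refine Submodule.add_mem _
    (Submodule.sum_mem _ fun i _ => Submodule.sum_mem _ fun j _ =>
      Submodule.smul_mem _ _ (hE i j hp))
    (Submodule.smul_mem _ _ (Submodule.sum_mem _ fun i _ => Submodule.sum_mem _ fun j _ => ?_))
  by_cases hij : i = j
  · subst hij
    have h : ((if i = i then 1 else 0) - X i) * X i * pderiv i (pderiv i p) =
        X i * pderiv i (pderiv i p) - (X i * pderiv i (X i * pderiv i p) - X i * pderiv i p) := by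
      simp [Derivation.leibniz]
      ring
    rw [h]
    exact Submodule.sub_mem _ (hE i i (hD i))
      (Submodule.sub_mem _ (hE i i (hE i i hp)) (hE i i hp))
  · have h : ((if i = j then 1 else 0) - X j) * X i * pderiv i (pderiv j p) =
        -(X i * pderiv i (X j * pderiv j p)) := by
      simp [Derivation.leibniz, pderiv_X_of_ne (Ne.symm hij), hij]
      ring
    rw [h]
    exact Submodule.neg_mem _ (hE i i (hE j j hp))

/-- A bounded solution of a finite homogeneous linear Volterra system vanishes. -/
theorem eq_zero_of_eq_integral_linear {ι : Type*} (S : Finset ι) (c : ι → ι → ℝ → ℝ)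
    (hc : ∀ a ∈ S, ∀ b ∈ S, Continuous (c a b)) (d : ι → ℝ → ℝ) (B : ℝ)
    (hB : ∀ a ∈ S, ∀ t, |d a t| ≤ B)
    (hd : ∀ a ∈ S, ∀ t, 0 ≤ t → d a t = ∫ s in (0 : ℝ)..t, ∑ b ∈ S, c a b s * d b s)
    {a : ι} (ha : a ∈ S) {T : ℝ} (hT : 0 ≤ T) : d a T = 0 := by
  have hcont : Continuous fun s => ∑ a ∈ S, ∑ b ∈ S, |c a b s| :=
    continuous_finsetSum _ fun a ha => continuous_finsetSum _ fun b hb => (hc a ha b hb).abs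
  obtain ⟨C, hC⟩ := (isCompact_Icc (a := (0 : ℝ)) (b := T)).bddAbove_image hcont.continuousOn
  have hC' : ∀ a ∈ S, ∀ s ∈ Set.Icc 0 T, ∑ b ∈ S, |c a b s| ≤ C := fun a ha s hs =>
    (Finset.single_le_sum (f := fun a => ∑ b ∈ S, |c a b s|)
      (fun _ _ => Finset.sum_nonneg fun _ _ => abs_nonneg _) ha).trans
      (hC (Set.mem_image_of_mem _ hs))
  have hB0 : 0 ≤ B := (abs_nonneg _).trans (hB a ha 0)
  have hC0 : 0 ≤ C := (Finset.sum_nonneg fun _ _ => abs_nonneg _).trans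
    (hC' a ha 0 ⟨le_rfl, hT⟩)
  have key : ∀ k : ℕ, ∀ a ∈ S, ∀ t ∈ Set.Icc 0 T, |d a t| ≤ B * ((C * t) ^ k / k.factorial) := by
    intro k
    induction k with
    | zero => intro a ha t _; simpa using hB a ha t
    | succ k ih =>
      intro a ha t ht
      have hle : ∀ s ∈ Set.Ioc 0 t, ‖∑ b ∈ S, c a b s * d b s‖ ≤
          (B * C ^ (k + 1) / k.factorial) * s ^ k := by
        intro s hs
        have hs' : s ∈ Set.Icc 0 T := ⟨hs.1.le, hs.2.trans ht.2⟩
        have hnn : 0 ≤ B * ((C * s) ^ k / k.factorial) := by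
          have := hs'.1
          positivity
        calc ‖∑ b ∈ S, c a b s * d b s‖ ≤ ∑ b ∈ S, ‖c a b s * d b s‖ := norm_sum_le _ _
          _ ≤ ∑ b ∈ S, |c a b s| * (B * ((C * s) ^ k / k.factorial)) := by
            refine Finset.sum_le_sum fun b hb => ?_
            rw [norm_mul, Real.norm_eq_abs, Real.norm_eq_abs]
            exact mul_le_mul_of_nonneg_left (ih b hb s hs') (abs_nonneg _)
          _ = (∑ b ∈ S, |c a b s|) * (B * ((C * s) ^ k / k.factorial)) := by
            rw [Finset.sum_mul]
          _ ≤ C * (B * ((C * s) ^ k / k.factorial)) :=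
            mul_le_mul_of_nonneg_right (hC' a ha s hs') hnn
          _ = _ := by rw [mul_pow, pow_succ]; ring
      rw [hd a ha t ht.1, ← Real.norm_eq_abs]
      refine (intervalIntegral.norm_integral_le_of_norm_le ht.1 (Filter.Eventually.of_forall hle)
        (Continuous.intervalIntegrable (by fun_prop) _ _)).trans (le_of_eq ?_)
      rw [intervalIntegral.integral_const_mul, integral_pow, Nat.factorial_succ]
      push_cast
      field_simp
      rw [mul_pow]
      ring
  have hlim : Filter.Tendsto (fun k : ℕ => B * ((C * T) ^ k / k.factorial)) Filter.atTop
      (nhds 0) := by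
    simpa using (FloorSemiring.tendsto_pow_div_factorial_atTop (C * T)).const_mul B
  have := ge_of_tendsto' hlim fun k => key k a ha T ⟨hT, le_rfl⟩
  exact abs_nonpos_iff.mp this

theorem integrable_comp_of_mem_isCompact {E Ω : Type*} [TopologicalSpace E] [MeasurableSpace E]
    [OpensMeasurableSpace E] {K : Set E} (hK : IsCompact K) [MeasurableSpace Ω] {μ : Measure Ω}
    [IsFiniteMeasure μ] {X : Ω → E} (hX : Measurable X) (hXK : ∀ ω, X ω ∈ K) {g : E → ℝ}
    (hg : Continuous g) : Integrable (fun ω => g (X ω)) μ := by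
  obtain ⟨C, hC⟩ := hK.exists_bound_of_continuousOn hg.continuousOn
  exact Integrable.of_bound (hg.measurable.comp hX).aestronglyMeasurable C
    (Filter.Eventually.of_forall fun ω => hC _ (hXK ω))

theorem abs_integral_sub_le_of_near {E Ω : Type*} [TopologicalSpace E] [MeasurableSpace E]
    [OpensMeasurableSpace E] {K : Set E} (hK : IsCompact K) [MeasurableSpace Ω] {μ : Measure Ω}
    [IsProbabilityMeasure μ] {X : Ω → E} (hX : Measurable X) (hXK : ∀ ω, X ω ∈ K) {f g : E → ℝ}
    (hf : Continuous f) (hg : Continuous g) {ε : ℝ} (h : ∀ x ∈ K, ‖g x - f x‖ < ε) :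
    |∫ ω, g (X ω) ∂μ - ∫ ω, f (X ω) ∂μ| ≤ ε := by
  rw [← integral_sub (integrable_comp_of_mem_isCompact hK hX hXK hg)
    (integrable_comp_of_mem_isCompact hK hX hXK hf), ← Real.norm_eq_abs]
  simpa using norm_integral_le_of_norm_le_const (μ := μ)
    (Filter.Eventually.of_forall fun ω => (h _ (hXK ω)).le)

open MvPolynomial in
/-- Two laws on a compact set which integrate all polynomials equally are equal. -/
theorem map_eq_map_of_integral_eval_eq {σ : Type*} [Fintype σ] {K : Set (σ → ℝ)}
    (hK : IsCompact K) {Ω Ω' : Type*} [MeasurableSpace Ω] [MeasurableSpace Ω']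
    {μ : Measure Ω} {μ' : Measure Ω'} [IsProbabilityMeasure μ] [IsProbabilityMeasure μ']
    {X : Ω → σ → ℝ} {X' : Ω' → σ → ℝ} (hX : Measurable X) (hX' : Measurable X')
    (hXK : ∀ ω, X ω ∈ K) (hXK' : ∀ ω, X' ω ∈ K)
    (h : ∀ p : MvPolynomial σ ℝ, ∫ ω, eval (X ω) p ∂μ = ∫ ω, eval (X' ω) p ∂μ') :
    μ.map X = μ'.map X' := by
  have := Measure.isProbabilityMeasure_map (μ := μ) hX.aemeasurable
  have := Measure.isProbabilityMeasure_map (μ := μ') hX'.aemeasurable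
  let coord (i : σ) : C(σ → ℝ, ℝ) := ⟨fun y => y i, continuous_apply i⟩
  let φ : MvPolynomial σ ℝ →ₐ[ℝ] C(σ → ℝ, ℝ) := aeval coord
  have hφ : ∀ p y, φ p y = eval y p := by
    intro p y
    induction p using MvPolynomial.induction_on with
    | C a => simp [φ]
    | add p q hp hq => simp [hp, hq]
    | mul_X p i hp => simp only [map_mul, ContinuousMap.mul_apply, hp, eval_X]; simp [φ, coord]
  have hsep : φ.range.SeparatesPoints := by
    intro x y hxy
    obtain ⟨i, hi⟩ := Function.ne_iff.mp hxy
    refine ⟨φ (MvPolynomial.X i), ⟨_, ⟨_, rfl⟩, rfl⟩, ?_⟩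
    simpa [hφ] using hi
  refine ext_of_forall_integral_eq_of_IsFiniteMeasure fun f => ?_
  rw [integral_map hX.aemeasurable f.continuous.aestronglyMeasurable,
    integral_map hX'.aemeasurable f.continuous.aestronglyMeasurable]
  refine eq_of_forall_dist_le fun ε hε => ?_
  rw [Real.dist_eq]
  obtain ⟨g, ⟨p, rfl⟩, hp⟩ :=
    ContinuousMap.exists_mem_subalgebra_near_continuous_of_isCompact_of_separatesPoints hsep
      f.toContinuousMap hK (half_pos hε)
  have h₁ := abs_integral_sub_le_of_near (μ := μ) hK hX hXK f.continuous (φ p).continuous hp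
  have h₂ := abs_integral_sub_le_of_near (μ := μ') hK hX' hXK' f.continuous (φ p).continuous hp
  have h₃ : ∫ ω, φ p (X ω) ∂μ = ∫ ω, φ p (X' ω) ∂μ' := by simpa only [hφ] using h p
  change |∫ ω, φ p (X ω) ∂μ - _| ≤ _ at h₁
  change |∫ ω, φ p (X' ω) ∂μ' - _| ≤ _ at h₂
  rw [h₃] at h₁
  rw [abs_le] at h₁ h₂ ⊢
  constructor <;> linarith [h₁.1, h₁.2, h₂.1, h₂.2]

theorem measurable_uncurry_toNNReal_of_isStronglyProgressive {E Ω : Type*} [TopologicalSpace E]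
    [TopologicalSpace.PseudoMetrizableSpace E] [MeasurableSpace E] [BorelSpace E]
    {mΩ : MeasurableSpace Ω} {ℱ : Filtration ℝ≥0 mΩ} {Y : ℝ≥0 → Ω → E}
    (hY : IsStronglyProgressive ℱ Y) : Measurable fun z : ℝ × Ω => Y z.1.toNNReal z.2 := by
  refine measurable_of_tendsto_metrizable
    (f := fun (n : ℕ) (z : ℝ × Ω) => Y (min z.1.toNNReal n) z.2) (fun n => ?_) ?_
  · have h := (hY n).measurable
    have hmap : Measurable[_, Subtype.instMeasurableSpace.prod (ℱ n)]
        fun z : ℝ × Ω => ((⟨min z.1.toNNReal n, Set.mem_Iic.mpr (min_le_right _ _)⟩ : Set.Iic (n : ℝ≥0)), z.2) := by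
      refine Measurable.prodMk ?_ ?_
      · exact Measurable.subtype_mk (by fun_prop)
      · exact measurable_snd.mono le_rfl (ℱ.le n)
    exact h.comp hmap
  · rw [tendsto_pi_nhds]
    intro z
    obtain ⟨N, hN⟩ := exists_nat_ge z.1.toNNReal
    refine tendsto_const_nhds.congr' ?_
    filter_upwards [Filter.eventually_ge_atTop N] with n hn
    rw [min_eq_left (hN.trans (by exact_mod_cast hn))]

theorem MvPolynomial.eval_eq_sum_of_support_subset {σ R : Type*} [CommSemiring R]
    {p : MvPolynomial σ R} {S : Finset (σ →₀ ℕ)} (h : p.support ⊆ S) (x : σ → R) :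
    eval x p = ∑ m ∈ S, coeff m p * eval x (monomial m 1) := by
  conv_lhs => rw [p.as_sum, map_sum]
  rw [Finset.sum_subset h fun m _ hm => by simp [notMem_support_iff.mp hm]]
  exact Finset.sum_congr rfl fun m _ => by simp [eval_monomial]

open MvPolynomial in
theorem continuous_coeff_polyGenerator {r : ℕ} {A : ℝ → Matrix (Fin r) (Fin r) ℝ}
    (hA : Continuous A) (p : MvPolynomial (Fin r) ℝ) (m : Fin r →₀ ℕ) :
    Continuous fun s => coeff m (polyGenerator (A s) p) := by
  simp only [polyGenerator, coeff_add, coeff_sum, coeff_smul]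
  refine Continuous.add (continuous_finsetSum _ fun i _ => continuous_finsetSum _ fun j _ => ?_)
    continuous_const
  exact (hA.matrix_elem i j).smul continuous_const

open MvPolynomial in
/-- The forward equation for polynomial moments of a solution of the martingale problem. -/
theorem integral_eval_sub_eq_intervalIntegral {r : ℕ} {A : ℝ → Matrix (Fin r) (Fin r) ℝ}
    (hA : Continuous A) {Ω : Type*} {mΩ : MeasurableSpace Ω} {μ : Measure Ω}
    [IsProbabilityMeasure μ] {ℱ : Filtration ℝ≥0 mΩ} {Y : ℝ≥0 → Ω → (Fin r → ℝ)}
    (hY : IsStronglyProgressive ℱ Y) {K : Set (Fin r → ℝ)} (hK : IsCompact K)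
    (hYK : ∀ t ω, Y t ω ∈ K)
    (hmart : ∀ f : (Fin r → ℝ) → ℝ, ContDiff ℝ 3 f →
      Martingale
        (fun t ω => f (Y t ω) - ∫ s in (0:ℝ)..(t:ℝ), (GA (A s) f (Y s.toNNReal ω) + GB f (Y s.toNNReal ω)))
        ℱ μ)
    (p : MvPolynomial (Fin r) ℝ) {S : Finset (Fin r →₀ ℕ)}
    (hS : ∀ s, (polyGenerator (A s) p).support ⊆ S) (t : ℝ≥0) :
    IntervalIntegrable (fun s => ∑ m ∈ S, coeff m (polyGenerator (A s) p) *
        ∫ ω, eval (Y s.toNNReal ω) (monomial m 1) ∂μ) volume 0 t ∧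
      ∫ ω, eval (Y t ω) p ∂μ - ∫ ω, eval (Y 0 ω) p ∂μ =
        ∫ s in (0 : ℝ)..t, ∑ m ∈ S, coeff m (polyGenerator (A s) p) *
          ∫ ω, eval (Y s.toNNReal ω) (monomial m 1) ∂μ := by
  have hmeas := measurable_uncurry_toNNReal_of_isStronglyProgressive hY
  have hYt : ∀ t, Measurable (Y t) := fun t =>
    ((hY.stronglyAdapted t).mono (ℱ.le t)).measurable
  have hint : ∀ (q : MvPolynomial (Fin r) ℝ) t, Integrable (fun ω => eval (Y t ω) q) μ :=
    fun q t => integrable_comp_of_mem_isCompact hK (hYt t) (hYK t)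
      (MvPolynomial.contDiff_eval q 0).continuous
  have hmean : ∀ s : ℝ, ∫ ω, eval (Y s.toNNReal ω) (polyGenerator (A s) p) ∂μ =
      ∑ m ∈ S, coeff m (polyGenerator (A s) p) *
        ∫ ω, eval (Y s.toNNReal ω) (monomial m 1) ∂μ := fun s => by
    simp_rw [MvPolynomial.eval_eq_sum_of_support_subset (hS s)]
    rw [integral_finsetSum _ fun m _ => (hint _ _).const_mul _]
    simp_rw [integral_const_mul]
  have hprod : Integrable
      (fun z : ℝ × Ω => eval (Y z.1.toNNReal z.2) (polyGenerator (A z.1) p))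
      ((volume.restrict (Set.uIoc 0 (t : ℝ))).prod μ) := by
    simp_rw [fun s : ℝ => MvPolynomial.eval_eq_sum_of_support_subset (hS s)]
    refine integrable_finsetSum _ fun m _ => ?_
    have hcont := continuous_coeff_polyGenerator hA p m
    have hev : Continuous fun y : Fin r → ℝ => eval y (monomial m (1 : ℝ)) :=
      (MvPolynomial.contDiff_eval _ 0).continuous
    obtain ⟨C, hC⟩ := hK.exists_bound_of_continuousOn hev.continuousOn
    have hbase : Integrable (fun s => coeff m (polyGenerator (A s) p))
        (volume.restrict (Set.uIoc 0 (t : ℝ))) := hcont.integrableOn_uIoc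
    exact (hbase.comp_fst μ).mul_bdd (c := C) (hev.measurable.comp hmeas).aestronglyMeasurable
      (Filter.Eventually.of_forall fun z => hC _ (hYK _ _))
  simp_rw [← hmean]
  refine ⟨intervalIntegrable_iff.mpr hprod.integral_prod_left, ?_⟩
  rw [intervalIntegral_integral_swap hprod]
  have hp3 := MvPolynomial.contDiff_eval p 3
  have hM := hmart _ hp3
  simp_rw [GA_add_GB_eval] at hM
  have hconst := hM.setIntegral_eq (zero_le (a := t)) (s := Set.univ) MeasurableSet.univ
  have hI : Integrable
      (fun ω => ∫ s in (0 : ℝ)..t, eval (Y s.toNNReal ω) (polyGenerator (A s) p)) μ := by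
    simpa only [intervalIntegral.integral_of_le t.coe_nonneg, Set.uIoc_of_le t.coe_nonneg] using
      hprod.integral_prod_right
  simp only [setIntegral_univ, NNReal.coe_zero, intervalIntegral.integral_same, sub_zero] at hconst
  rw [integral_sub (hint p t) hI] at hconst
  linarith

theorem abs_integral_eval_monomial_le_one {σ Ω : Type*} [Fintype σ] [MeasurableSpace Ω]
    {μ : Measure Ω} [IsProbabilityMeasure μ] {X : Ω → σ → ℝ} (hX : ∀ ω, X ω ∈ stdSimplex ℝ σ)
    (a : σ →₀ ℕ) : |∫ ω, (MvPolynomial.monomial a (1 : ℝ)).eval (X ω) ∂μ| ≤ 1 := by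
  have h : ∀ ω, ‖(MvPolynomial.monomial a (1 : ℝ)).eval (X ω)‖ ≤ 1 := fun ω => by
    rw [MvPolynomial.eval_monomial, one_mul, Finsupp.prod, norm_prod]
    refine Finset.prod_le_one (fun _ _ => norm_nonneg _) fun i _ => ?_
    rw [norm_pow, Real.norm_of_nonneg ((hX ω).1 i)]
    exact pow_le_one₀ ((hX ω).1 i) (mem_Icc_of_mem_stdSimplex (hX ω) i).2
  simpa using norm_integral_le_of_norm_le_const (μ := μ) (Filter.Eventually.of_forall h)

/-- Uniqueness of one-dimensional distributions for the martingale problem for `G_AB = G_A + G_B` on C³ functions: two solutions with the same initial distribution have equal moments `E[∏ᵢ Yᵢ(t)^αᵢ]` for every multi-index `α`, and hence equal one-dimensional distributions, at every time `t ≥ 0`. -/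
theorem martingale_problem_GAB_one_dim_uniqueness
    (r : ℕ) (hr : 2 ≤ r)
    (A : ℝ → Matrix (Fin r) (Fin r) ℝ)
    (hAcont : Continuous A)
    (hAQ : ∀ t : ℝ, 0 ≤ t → IsQMatrix (A t))
    {Ω : Type*} {mΩ : MeasurableSpace Ω} (μ : Measure Ω) [IsProbabilityMeasure μ]
    (ℱ : Filtration ℝ≥0 mΩ)
    (Y : ℝ≥0 → Ω → (Fin r → ℝ))
    (hprog : ProgMeasurable ℱ Y)
    (hK : ∀ t ω, (∀ i, 0 ≤ Y t ω i) ∧ ∑ i, Y t ω i = 1)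
    (hmart : ∀ f : (Fin r → ℝ) → ℝ, ContDiff ℝ 3 f →
      Martingale
        (fun t ω => f (Y t ω) - ∫ s in (0:ℝ)..(t:ℝ), (GA (A s) f (Y s.toNNReal ω) + GB f (Y s.toNNReal ω)))
        ℱ μ)
    {Ω' : Type*} {mΩ' : MeasurableSpace Ω'} (μ' : Measure Ω') [IsProbabilityMeasure μ']
    (ℱ' : Filtration ℝ≥0 mΩ')
    (Y' : ℝ≥0 → Ω' → (Fin r → ℝ))
    (hprog' : ProgMeasurable ℱ' Y')
    (hK' : ∀ t ω, (∀ i, 0 ≤ Y' t ω i) ∧ ∑ i, Y' t ω i = 1)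
    (hmart' : ∀ f : (Fin r → ℝ) → ℝ, ContDiff ℝ 3 f →
      Martingale
        (fun t ω => f (Y' t ω) - ∫ s in (0:ℝ)..(t:ℝ), (GA (A s) f (Y' s.toNNReal ω) + GB f (Y' s.toNNReal ω)))
        ℱ' μ')
    (h0 : μ.map (Y 0) = μ'.map (Y' 0)) :
    ∀ t : ℝ≥0,
      (∀ α : Fin r → ℕ,
        (∫ ω, ∏ i, (Y t ω i) ^ α i ∂μ) = ∫ ω, ∏ i, (Y' t ω i) ^ α i ∂μ') ∧
      μ.map (Y t) = μ'.map (Y' t) := by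
  have hK_compact : IsCompact (stdSimplex ℝ (Fin r)) := isCompact_stdSimplex ℝ (Fin r)
  have hYt : ∀ t, Measurable (Y t) := fun t =>
    ((IsStronglyProgressive.stronglyAdapted hprog t).mono (ℱ.le t)).measurable
  have hYt' : ∀ t, Measurable (Y' t) := fun t =>
    ((IsStronglyProgressive.stronglyAdapted hprog' t).mono (ℱ'.le t)).measurable
  have hinit : ∀ p : MvPolynomial (Fin r) ℝ,
      ∫ ω, p.eval (Y 0 ω) ∂μ = ∫ ω, p.eval (Y' 0 ω) ∂μ' := fun p => by
    have hp := (MvPolynomial.contDiff_eval p 0).continuous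
    rw [← integral_map (hYt 0).aemeasurable hp.aestronglyMeasurable, h0,
      integral_map (hYt' 0).aemeasurable hp.aestronglyMeasurable]
  have hmoment : ∀ (m : Fin r →₀ ℕ) (t : ℝ≥0),
      ∫ ω, (MvPolynomial.monomial m (1 : ℝ)).eval (Y t ω) ∂μ =
        ∫ ω, (MvPolynomial.monomial m (1 : ℝ)).eval (Y' t ω) ∂μ' := by
    intro m t
    let n := m.degree
    let S : Finset (Fin r →₀ ℕ) := (Finsupp.finite_of_degree_le (σ := Fin r) n).toFinset
    have hmS : ∀ a, a ∈ S ↔ a.degree ≤ n := fun a => by simp [S]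
    have hS : ∀ a ∈ S, ∀ s,
        (polyGenerator (A s) (MvPolynomial.monomial a 1)).support ⊆ S := by
      intro a ha s b hb
      have h := polyGenerator_mem_restrictTotalDegree (n := n) (A s)
        (p := MvPolynomial.monomial a 1)
        ((MvPolynomial.mem_restrictTotalDegree _ _ _).mpr
          ((MvPolynomial.totalDegree_monomial_le _ _).trans ((hmS a).mp ha)))
      rw [MvPolynomial.mem_restrictTotalDegree] at h
      exact (hmS b).mpr ((MvPolynomial.le_totalDegree hb).trans h)
    let d : (Fin r →₀ ℕ) → ℝ → ℝ := fun a t =>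
      ∫ ω, (MvPolynomial.monomial a (1 : ℝ)).eval (Y t.toNNReal ω) ∂μ -
        ∫ ω, (MvPolynomial.monomial a (1 : ℝ)).eval (Y' t.toNNReal ω) ∂μ'
    have hd := eq_zero_of_eq_integral_linear S
      (fun a b s => (polyGenerator (A s) (MvPolynomial.monomial a 1)).coeff b)
      (fun a _ b _ => continuous_coeff_polyGenerator hAcont _ b) d 2
      (fun a _ t => by
        have h := abs_integral_eval_monomial_le_one (μ := μ) (hK t.toNNReal) a
        have h' := abs_integral_eval_monomial_le_one (μ := μ') (hK' t.toNNReal) a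
        exact (abs_sub _ _).trans (by linarith))
      (fun a ha t ht => by
        lift t to ℝ≥0 using ht
        obtain ⟨hi, h⟩ := integral_eval_sub_eq_intervalIntegral hAcont hprog hK_compact hK hmart
          (MvPolynomial.monomial a 1) (hS a ha) t
        obtain ⟨hi', h'⟩ := integral_eval_sub_eq_intervalIntegral hAcont hprog' hK_compact hK' hmart'
          (MvPolynomial.monomial a 1) (hS a ha) t
        simp only [d, mul_sub, Finset.sum_sub_distrib, Real.toNNReal_coe]
        rw [intervalIntegral.integral_sub hi hi', ← h, ← h', hinit]
        ring)
      ((hmS m).mpr le_rfl) t.2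
    simpa [d, sub_eq_zero] using hd
  intro t
  have hpoly : ∀ p : MvPolynomial (Fin r) ℝ,
      ∫ ω, p.eval (Y t ω) ∂μ = ∫ ω, p.eval (Y' t ω) ∂μ' := fun p => by
    simp_rw [MvPolynomial.eval_eq_sum_of_support_subset (subset_refl p.support)]
    have hev : ∀ a : Fin r →₀ ℕ,
        Continuous fun y : Fin r → ℝ => (MvPolynomial.monomial a (1 : ℝ)).eval y :=
      fun a => (MvPolynomial.contDiff_eval _ 0).continuous
    rw [integral_finsetSum _ fun a _ =>
        (integrable_comp_of_mem_isCompact hK_compact (hYt t) (hK t) (hev a)).const_mul _,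
      integral_finsetSum _ fun a _ =>
        (integrable_comp_of_mem_isCompact hK_compact (hYt' t) (hK' t) (hev a)).const_mul _]
    simp_rw [integral_const_mul, hmoment]
  refine ⟨fun α => ?_,
    map_eq_map_of_integral_eval_eq hK_compact (hYt t) (hYt' t) (hK t) (hK' t) hpoly⟩
  simpa [MvPolynomial.eval_monomial, Finsupp.prod_fintype] using
    hmoment (Finsupp.equivFunOnFinite.symm α) t
end
end

section
/- Let A be a continuous Q-matrix-valued function on [0,∞) and let X and X̃ be K-valued progressively measurable processes (on possibly different filtered probability spaces) each solving the martingale problem for G_A on C², i.e. for every f : ℝ^r → ℝ of class C², the process f(X(t)) − ∫_0^t G_A(s) f(X(s)) ds, t ≥ 0, is a martingale, and likewise for X̃. If X(0) and X̃(0) have the same distribution, then for every t ≥ 0 and every multi-index α ∈ ℤ_+^r, E[ ∏_{i=1}^r X_i(t)^{α_i} ] = E[ ∏_{i=1}^r X̃_i(t)^{α_i} ]; consequently X(t) and X̃(t) have the same distribution for each t ≥ 0. -/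
open scoped BigOperators NNReal
open Finset MeasureTheory

noncomputable section

theorem GA_prod_apply {r : ℕ} {ι : Type*} [Fintype ι] [DecidableEq ι]
    (M : Matrix (Fin r) (Fin r) ℝ) (w : ι → Fin r) (p : Fin r → ℝ) :
    GA M (fun x => ∏ k, x (w k)) p =
      ∑ k, ∑ i, M i (w k) * ∏ l, p (Function.update w k i l) := by
  have hd : HasFDerivAt (fun x : Fin r → ℝ => ∏ k, x (w k))
      (∑ k, (∏ l ∈ univ.erase k, p (w l)) •
        (ContinuousLinearMap.proj (w k) : (Fin r → ℝ) →L[ℝ] ℝ)) p :=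
    HasFDerivAt.finsetProd fun k _ => hasFDerivAt_apply (w k) p
  have hu (k : ι) (i : Fin r) : ∏ l, p (Function.update w k i l) =
      p i * ∏ l ∈ univ.erase k, p (w l) := by
    rw [← Finset.mul_prod_erase univ _ (Finset.mem_univ k), Function.update_self]
    congr 1
    exact Finset.prod_congr rfl fun l hl => by
      rw [Function.update_of_ne (Finset.ne_of_mem_erase hl)]
  simp only [GA, hd.fderiv, hu, _root_.sum_apply, _root_.smul_apply,
    ContinuousLinearMap.proj_apply, smul_eq_mul, Pi.single_apply, Finset.mul_sum]
  rw [Finset.sum_comm (s := (univ : Finset ι))]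
  refine Finset.sum_congr rfl fun i _ => ?_
  rw [Finset.sum_comm]
  refine Finset.sum_congr rfl fun k _ => ?_
  rw [Finset.sum_eq_single (w k)]
  · simp only [if_true]; ring
  · intro j _ hj
    simp [hj.symm]
  · simp

theorem measurable_min_of_isStronglyProgressive {r : ℕ} {Ω : Type*} {mΩ : MeasurableSpace Ω}
    {ℱ : Filtration ℝ≥0 mΩ} {X : ℝ≥0 → Ω → (Fin r → ℝ)} (hX : IsStronglyProgressive ℱ X)
    (T : ℝ≥0) : Measurable fun q : ℝ × Ω => X (min q.1.toNNReal T) q.2 := by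
  have h := (hX T).measurable
  have hle : Measurable[_, Subtype.instMeasurableSpace.prod (ℱ T)]
      (fun q : ℝ × Ω => ((⟨min q.1.toNNReal T, Set.mem_Iic.2 (min_le_right _ _)⟩ : Set.Iic T), q.2)) := by
    refine Measurable.prodMk ?_ ?_
    · exact Measurable.subtype_mk (measurable_fst.real_toNNReal.min measurable_const)
    · exact measurable_snd.mono le_rfl (ℱ.le T)
  exact h.comp hle

theorem prod_mem_Icc_zero_one {ι κ : Type*} [Fintype ι] (w : ι → κ) {y : κ → ℝ}
    (hy : y ∈ Set.Icc 0 1) : ∏ k, y (w k) ∈ Set.Icc (0 : ℝ) 1 :=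
  ⟨Finset.prod_nonneg fun k _ => hy.1 (w k),
    Finset.prod_le_one (fun k _ => hy.1 (w k)) fun k _ => hy.2 (w k)⟩

theorem norm_prod_le_one {ι κ : Type*} [Fintype ι] (w : ι → κ) {y : κ → ℝ}
    (hy : y ∈ Set.Icc 0 1) : ‖∏ k, y (w k)‖ ≤ 1 := by
  obtain ⟨h0, h1⟩ := prod_mem_Icc_zero_one w hy
  rwa [Real.norm_of_nonneg h0]

theorem measurable_prod_eval {ι κ Ω : Type*} [Fintype ι] [MeasurableSpace Ω] (w : ι → κ)
    {Y : Ω → κ → ℝ} (hY : Measurable Y) : Measurable fun ω => ∏ k, Y ω (w k) :=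
  Finset.measurable_fun_prod _ fun k _ => measurable_pi_iff.1 hY (w k)

theorem integrable_prod_eval {ι κ Ω : Type*} [Fintype ι] [MeasurableSpace Ω] {μ : Measure Ω}
    [IsFiniteMeasure μ] (w : ι → κ) {Y : Ω → κ → ℝ} (hY : Measurable Y)
    (hI : ∀ ω, Y ω ∈ Set.Icc 0 1) : Integrable (fun ω => ∏ k, Y ω (w k)) μ :=
  Integrable.of_bound (measurable_prod_eval w hY).aestronglyMeasurable 1
    (.of_forall fun ω => norm_prod_le_one w (hI ω))

/-- A monomial `∏ i, y i ^ α i` written as a product of coordinates. -/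
theorem prod_pow_eq_prod_sigma {κ : Type*} [Fintype κ] (α : κ → ℕ) (y : κ → ℝ) :
    ∏ i, y i ^ α i = ∏ k : (Σ i, Fin (α i)), y k.1 := by
  rw [Fintype.prod_sigma]
  simp

theorem integral_sum_monomial {κ Ω : Type*} [Fintype κ] [MeasurableSpace Ω] {μ : Measure Ω}
    [IsFiniteMeasure μ] {Y : Ω → κ → ℝ} (hY : Measurable Y) (hI : ∀ ω, Y ω ∈ Set.Icc 0 1)
    (P : MvPolynomial κ ℝ) :
    ∫ ω, ∑ d ∈ P.support, P.coeff d * ∏ i, Y ω i ^ d i ∂μ =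
      ∑ d ∈ P.support, P.coeff d * ∫ ω, ∏ i, Y ω i ^ d i ∂μ := by
  rw [integral_finsetSum]
  · simp_rw [integral_const_mul]
  · intro d _
    simp_rw [prod_pow_eq_prod_sigma]
    exact (integrable_prod_eval _ hY hI).const_mul _

/-- A finite measure on `ℝ^r` carried by the unit cube is determined by its moments. -/
theorem measure_ext_of_moments {r : ℕ} {Ω Ω' : Type*} {mΩ : MeasurableSpace Ω}
    {mΩ' : MeasurableSpace Ω'} (μ : Measure Ω) [IsFiniteMeasure μ] (μ' : Measure Ω')
    [IsFiniteMeasure μ'] {Y : Ω → (Fin r → ℝ)} {Y' : Ω' → (Fin r → ℝ)}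
    (hY : Measurable Y) (hY' : Measurable Y') (hI : ∀ ω, Y ω ∈ Set.Icc 0 1)
    (hI' : ∀ ω, Y' ω ∈ Set.Icc 0 1)
    (h : ∀ α : Fin r → ℕ, (∫ ω, ∏ i, (Y ω i) ^ α i ∂μ) = ∫ ω, ∏ i, (Y' ω i) ^ α i ∂μ') :
    μ.map Y = μ'.map Y' := by
  let S : Set (Fin r → ℝ) := Set.Icc 0 1
  let Z : Ω → S := fun ω => ⟨Y ω, hI ω⟩
  let Z' : Ω' → S := fun ω => ⟨Y' ω, hI' ω⟩
  have hZ : Measurable Z := hY.subtype_mk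
  have hZ' : Measurable Z' := hY'.subtype_mk
  have : CompactSpace S := isCompact_iff_compactSpace.mp isCompact_Icc
  let c : Fin r → BoundedContinuousFunction S ℝ := fun i =>
    BoundedContinuousFunction.mkOfCompact ⟨fun s => s.1 i, (continuous_apply i).comp continuous_subtype_val⟩
  let B : StarSubalgebra ℝ (BoundedContinuousFunction S ℝ) :=
    { (MvPolynomial.aeval (R := ℝ) c).range with
      star_mem' := fun {a} ha => by rwa [show star a = a from by ext; simp] }
  have key : μ.map Z = μ'.map Z' := by
    refine ext_of_forall_mem_subalgebra_integral_eq_of_polish (𝕜 := ℝ) (A := B) ?_ ?_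
    · intro x y hxy
      obtain ⟨i, hi⟩ : ∃ i, x.1 i ≠ y.1 i := by
        by_contra! hc
        exact hxy (Subtype.ext (funext hc))
      refine ⟨_, ⟨_, ⟨c i, ⟨MvPolynomial.X i, MvPolynomial.aeval_X c i⟩, rfl⟩, rfl⟩, hi⟩
    · rintro g ⟨P, rfl⟩
      have hP (s : S) : (MvPolynomial.aeval (R := ℝ) c P) s =
          ∑ d ∈ P.support, P.coeff d * ∏ i, (s.1 i) ^ d i := by
        rw [MvPolynomial.aeval_def, MvPolynomial.eval₂_eq']
        simp [BoundedContinuousFunction.sum_apply, c]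
      have hc : Continuous fun s : S => (MvPolynomial.aeval (R := ℝ) c P) s :=
        BoundedContinuousFunction.continuous _
      change ∫ s, (MvPolynomial.aeval (R := ℝ) c P) s ∂_ =
        ∫ s, (MvPolynomial.aeval (R := ℝ) c P) s ∂_
      rw [integral_map hZ.aemeasurable hc.aestronglyMeasurable,
        integral_map hZ'.aemeasurable hc.aestronglyMeasurable]
      simp_rw [hP]
      change ∫ ω, ∑ d ∈ P.support, P.coeff d * ∏ i, Y ω i ^ d i ∂μ =
        ∫ ω, ∑ d ∈ P.support, P.coeff d * ∏ i, Y' ω i ^ d i ∂μ'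
      rw [integral_sum_monomial hY hI, integral_sum_monomial hY' hI']
      simp_rw [h]
  have hm : Measurable (Subtype.val : S → (Fin r → ℝ)) := measurable_subtype_coe
  have := congrArg (Measure.map (Subtype.val : S → (Fin r → ℝ))) key
  rwa [Measure.map_map hm hZ, Measure.map_map hm hZ'] at this

section Moments

variable {r : ℕ} {A : ℝ → Matrix (Fin r) (Fin r) ℝ} {ι : Type*} [Fintype ι]
  {Ω : Type*} {mΩ : MeasurableSpace Ω} {μ : Measure Ω} [IsProbabilityMeasure μ]
  {ℱ : Filtration ℝ≥0 mΩ} {X : ℝ≥0 → Ω → (Fin r → ℝ)}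

/-- The moment of the process `X` at time `s` indexed by the word `w`. -/
def wordMoment (μ : Measure Ω) (X : ℝ≥0 → Ω → (Fin r → ℝ)) (s : ℝ) (w : ι → Fin r) : ℝ :=
  ∫ ω, ∏ k, X s.toNNReal ω (w k) ∂μ

theorem norm_wordMoment_le_one (hI : ∀ t ω, X t ω ∈ Set.Icc 0 1) (s : ℝ) (w : ι → Fin r) :
    ‖wordMoment μ X s w‖ ≤ 1 := by
  simpa [wordMoment] using norm_integral_le_of_norm_le_const (μ := μ)
    (.of_forall fun ω => norm_prod_le_one w (hI s.toNNReal ω))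

variable [DecidableEq ι]

/-- The linear vector field governing the moments indexed by words. -/
def wordField (M : Matrix (Fin r) (Fin r) ℝ) (x : (ι → Fin r) → ℝ) (w : ι → Fin r) : ℝ :=
  ∑ k, ∑ i, M i (w k) * x (Function.update w k i)

theorem wordMoment_eq_add_integral (hA : Continuous A) (hprog : IsStronglyProgressive ℱ X)
    (hI : ∀ t ω, X t ω ∈ Set.Icc 0 1)
    (hmart : ∀ f : (Fin r → ℝ) → ℝ, ContDiff ℝ 2 f →
      Martingale
        (fun t ω => f (X t ω) - ∫ s in (0:ℝ)..(t:ℝ), GA (A s) f (X s.toNNReal ω)) ℱ μ)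
    (t : ℝ) (ht : 0 ≤ t) (w : ι → Fin r) :
    wordMoment μ X t w =
      wordMoment μ X 0 w + ∫ s in (0 : ℝ)..t, wordField (A s) (wordMoment μ X s) w := by
  lift t to ℝ≥0 using ht
  have hX (s : ℝ≥0) : Measurable (X s) :=
    ((hprog.stronglyAdapted s).mono (ℱ.le s)).measurable
  let Y : ℝ × Ω → (Fin r → ℝ) := fun q => X (min q.1.toNNReal t) q.2
  have hY : Measurable Y := measurable_min_of_isStronglyProgressive hprog t
  have hmin {s : ℝ} (hs : s ∈ Set.uIcc (0 : ℝ) t) : min s.toNNReal t = s.toNNReal := by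
    rw [Set.uIcc_of_le t.coe_nonneg] at hs
    exact min_eq_left (Real.toNNReal_le_iff_le_coe.2 hs.2)
  let F : (ι → Fin r) → ℝ → Ω → ℝ := fun v s ω => ∏ l, Y (s, ω) (v l)
  let H : ℝ → Ω → ℝ := fun s ω => wordField (A s) (fun v => F v s ω) w
  have hpath (ω : Ω) : ∫ s in (0 : ℝ)..t, GA (A s) (fun x => ∏ k, x (w k)) (X s.toNNReal ω) =
      ∫ s in (0 : ℝ)..t, H s ω := by
    refine intervalIntegral.integral_congr fun s hs => ?_
    simp only [GA_prod_apply, H, F, Y, wordField, hmin hs]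
  have hterm (k : ι) (i : Fin r) : Integrable
      (fun q : ℝ × Ω => A q.1 i (w k) * F (Function.update w k i) q.1 q.2)
      ((volume.restrict (Set.uIoc (0 : ℝ) t)).prod μ) := by
    have hAi : Continuous fun s => A s i (w k) := hA.matrix_elem i (w k)
    have h1 : Integrable (fun s => A s i (w k)) (volume.restrict (Set.uIoc (0 : ℝ) t)) :=
      (intervalIntegrable_iff.1 (hAi.intervalIntegrable 0 t))
    exact (h1.comp_fst μ).mul_bdd (c := 1) (measurable_prod_eval _ hY).aestronglyMeasurable
      (.of_forall fun q => norm_prod_le_one _ (hI _ _))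
  have hH : Integrable (Function.uncurry H) ((volume.restrict (Set.uIoc (0 : ℝ) t)).prod μ) :=
    integrable_finsetSum _ fun k _ => integrable_finsetSum _ fun i _ => hterm k i
  have hHint : Integrable (fun ω => ∫ s in (0 : ℝ)..t, H s ω) μ := by
    simp_rw [intervalIntegral.integral_of_le t.coe_nonneg]
    rw [Set.uIoc_of_le t.coe_nonneg] at hH
    exact hH.integral_prod_right
  have hF (v : ι → Fin r) (s : ℝ) : Integrable (F v s) μ :=
    integrable_prod_eval v (hX (min s.toNNReal t)) fun ω => hI _ ω
  have hswap : ∫ ω, (∫ s in (0 : ℝ)..t, H s ω) ∂μ =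
      ∫ s in (0 : ℝ)..t, wordField (A s) (wordMoment μ X s) w := by
    rw [← intervalIntegral_integral_swap hH]
    refine intervalIntegral.integral_congr fun s hs => ?_
    simp only [H, wordField]
    rw [integral_finsetSum _ fun k _ => integrable_finsetSum _ fun i _ => (hF _ s).const_mul _]
    refine Finset.sum_congr rfl fun k _ => ?_
    rw [integral_finsetSum _ fun i _ => (hF _ s).const_mul _]
    refine Finset.sum_congr rfl fun i _ => ?_
    rw [integral_const_mul]
    simp only [F, Y, hmin hs, wordMoment]
  have hM := (hmart (fun x => ∏ k, x (w k))
    (contDiff_prod fun k _ => contDiff_apply ℝ ℝ (w k))).setIntegral_eq (show 0 ≤ t from zero_le)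
      MeasurableSet.univ
  simp only [hpath, setIntegral_univ] at hM
  rw [integral_sub (integrable_prod_eval w (hX t) (hI t)) hHint, hswap] at hM
  simp only [NNReal.coe_zero, intervalIntegral.integral_same, sub_zero] at hM
  simp only [wordMoment, Real.toNNReal_coe, Real.toNNReal_zero]
  linarith

theorem intervalIntegrable_wordField (hA : Continuous A) (hprog : IsStronglyProgressive ℱ X)
    (hI : ∀ t ω, X t ω ∈ Set.Icc 0 1) (w : ι → Fin r) (a b : ℝ) :
    IntervalIntegrable (fun s => wordField (A s) (wordMoment μ X s) w) volume a b := by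
  have hmeas (v : ι → Fin r) :
      AEStronglyMeasurable (fun s => wordMoment μ X s v) (volume.restrict (Set.uIoc a b)) := by
    have h : StronglyMeasurable fun s : ℝ =>
        ∫ ω, ∏ k, X (min s.toNNReal (max a b).toNNReal) ω (v k) ∂μ :=
      (measurable_prod_eval v (measurable_min_of_isStronglyProgressive hprog
        (max a b).toNNReal)).stronglyMeasurable.integral_prod_right
    refine h.aestronglyMeasurable.congr ?_
    filter_upwards [ae_restrict_mem measurableSet_uIoc] with s hs
    rw [min_eq_left (Real.toNNReal_le_toNNReal hs.2), wordMoment]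
  rw [intervalIntegrable_iff]
  refine integrable_finsetSum _ fun k _ => integrable_finsetSum _ fun i _ => ?_
  exact (intervalIntegrable_iff.1
    ((hA.matrix_elem i (w k)).intervalIntegrable a b)).mul_bdd (c := 1) (hmeas _)
    (.of_forall fun s => norm_wordMoment_le_one hI s _)

theorem continuous_wordMoment (hA : Continuous A) (hprog : IsStronglyProgressive ℱ X)
    (hI : ∀ t ω, X t ω ∈ Set.Icc 0 1)
    (hmart : ∀ f : (Fin r → ℝ) → ℝ, ContDiff ℝ 2 f →
      Martingale
        (fun t ω => f (X t ω) - ∫ s in (0:ℝ)..(t:ℝ), GA (A s) f (X s.toNNReal ω)) ℱ μ)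
    (w : ι → Fin r) : Continuous fun s => wordMoment μ X s w := by
  have h : (fun s => wordMoment μ X s w) = fun s => wordMoment μ X 0 w +
      ∫ u in (0 : ℝ)..max s 0, wordField (A u) (wordMoment μ X u) w := by
    ext s
    rw [← wordMoment_eq_add_integral hA hprog hI hmart _ (le_max_right s 0) w]
    simp [wordMoment, Real.toNNReal]
  rw [h]
  exact continuous_const.add ((intervalIntegral.continuous_primitive
    (intervalIntegrable_wordField hA hprog hI w) 0).comp (continuous_id.max continuous_const))

theorem hasDerivWithinAt_wordMoment (hA : Continuous A) (hprog : IsStronglyProgressive ℱ X)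
    (hI : ∀ t ω, X t ω ∈ Set.Icc 0 1)
    (hmart : ∀ f : (Fin r → ℝ) → ℝ, ContDiff ℝ 2 f →
      Martingale
        (fun t ω => f (X t ω) - ∫ s in (0:ℝ)..(t:ℝ), GA (A s) f (X s.toNNReal ω)) ℱ μ)
    {t : ℝ} (ht : 0 ≤ t) :
    HasDerivWithinAt (fun s => (wordMoment μ X s : (ι → Fin r) → ℝ))
      (wordField (A t) (wordMoment μ X t)) (Set.Ici t) t := by
  refine hasDerivWithinAt_pi.2 fun w => ?_
  have hc : Continuous fun s => wordField (A s) (wordMoment μ X s) w :=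
    continuous_finsetSum _ fun k _ => continuous_finsetSum _ fun i _ =>
      (hA.matrix_elem i (w k)).mul (continuous_wordMoment hA hprog hI hmart _)
  have hd := ((hc.integral_hasStrictDerivAt 0 t).hasDerivAt.const_add
    (wordMoment μ X 0 w)).hasDerivWithinAt (s := Set.Ici t)
  exact hd.congr (fun s hs => wordMoment_eq_add_integral hA hprog hI hmart s (ht.trans hs) w)
    (wordMoment_eq_add_integral hA hprog hI hmart t ht w)

end Moments

theorem wordField_sub {r : ℕ} {ι : Type*} [Fintype ι] [DecidableEq ι]
    (M : Matrix (Fin r) (Fin r) ℝ) (x y : (ι → Fin r) → ℝ) :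
    wordField M (x - y) = wordField M x - wordField M y := by
  ext w
  simp [wordField, mul_sub, Finset.sum_sub_distrib]

theorem norm_wordField_le {r : ℕ} {ι : Type*} [Fintype ι] [DecidableEq ι]
    {M : Matrix (Fin r) (Fin r) ℝ} {C : ℝ} (hC : 0 ≤ C) (hM : ∀ i j, ‖M i j‖ ≤ C)
    (x : (ι → Fin r) → ℝ) : ‖wordField M x‖ ≤ Fintype.card ι * (r * C) * ‖x‖ := by
  refine (pi_norm_le_iff_of_nonneg (by positivity)).2 fun w => ?_
  calc ‖wordField M x w‖ ≤ ∑ k : ι, ∑ i : Fin r, C * ‖x‖ := by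
        refine norm_sum_le_of_le _ fun k _ => norm_sum_le_of_le _ fun i _ => ?_
        rw [norm_mul]
        exact mul_le_mul (hM _ _) (norm_le_pi_norm _ _) (norm_nonneg _) hC
    _ = Fintype.card ι * (r * C) * ‖x‖ := by
        simp [mul_assoc]

theorem exists_norm_entry_le {r : ℕ} {A : ℝ → Matrix (Fin r) (Fin r) ℝ} (hA : Continuous A)
    (T : ℝ) : ∃ C, 0 ≤ C ∧ ∀ s ∈ Set.Icc 0 T, ∀ i j, ‖A s i j‖ ≤ C := by
  obtain ⟨C, hC⟩ := (isCompact_Icc (a := (0 : ℝ)) (b := T)).exists_bound_of_continuousOn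
    (f := fun s (q : Fin r × Fin r) => A s q.1 q.2)
    (continuous_pi fun q : Fin r × Fin r => hA.matrix_elem q.1 q.2).continuousOn
  exact ⟨max C 0, le_max_right _ _, fun s hs i j =>
    ((norm_le_pi_norm (fun q : Fin r × Fin r => A s q.1 q.2) (i, j)).trans (hC s hs)).trans
      (le_max_left _ _)⟩

theorem mem_Icc_of_mem_simplex {r : ℕ} {p : Fin r → ℝ} (hp : (∀ i, 0 ≤ p i) ∧ ∑ i, p i = 1) :
    p ∈ Set.Icc 0 1 :=
  ⟨hp.1, fun i =>
    (Finset.single_le_sum (fun j _ => hp.1 j) (Finset.mem_univ i)).trans_eq hp.2⟩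

/-- Uniqueness of one-dimensional distributions for the martingale problem for `G_A` on C² functions: two solutions with the same initial distribution have equal moments `E[∏ᵢ Xᵢ(t)^αᵢ]` for every multi-index `α`, and hence equal one-dimensional distributions, at every time `t ≥ 0`. -/
theorem martingale_problem_GA_one_dim_uniqueness
    (r : ℕ) (hr : 2 ≤ r)
    (A : ℝ → Matrix (Fin r) (Fin r) ℝ)
    (hAcont : Continuous A)
    (hAQ : ∀ t : ℝ, 0 ≤ t → IsQMatrix (A t))
    {Ω : Type*} {mΩ : MeasurableSpace Ω} (μ : Measure Ω) [IsProbabilityMeasure μ]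
    (ℱ : Filtration ℝ≥0 mΩ)
    (X : ℝ≥0 → Ω → (Fin r → ℝ))
    (hprog : ProgMeasurable ℱ X)
    (hK : ∀ t ω, (∀ i, 0 ≤ X t ω i) ∧ ∑ i, X t ω i = 1)
    (hmart : ∀ f : (Fin r → ℝ) → ℝ, ContDiff ℝ 2 f →
      Martingale
        (fun t ω => f (X t ω) - ∫ s in (0:ℝ)..(t:ℝ), GA (A s) f (X s.toNNReal ω))
        ℱ μ)
    {Ω' : Type*} {mΩ' : MeasurableSpace Ω'} (μ' : Measure Ω') [IsProbabilityMeasure μ']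
    (ℱ' : Filtration ℝ≥0 mΩ')
    (X' : ℝ≥0 → Ω' → (Fin r → ℝ))
    (hprog' : ProgMeasurable ℱ' X')
    (hK' : ∀ t ω, (∀ i, 0 ≤ X' t ω i) ∧ ∑ i, X' t ω i = 1)
    (hmart' : ∀ f : (Fin r → ℝ) → ℝ, ContDiff ℝ 2 f →
      Martingale
        (fun t ω => f (X' t ω) - ∫ s in (0:ℝ)..(t:ℝ), GA (A s) f (X' s.toNNReal ω))
        ℱ' μ')
    (h0 : μ.map (X 0) = μ'.map (X' 0)) :
    ∀ t : ℝ≥0,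
      (∀ α : Fin r → ℕ,
        (∫ ω, ∏ i, (X t ω i) ^ α i ∂μ) = ∫ ω, ∏ i, (X' t ω i) ^ α i ∂μ') ∧
      μ.map (X t) = μ'.map (X' t) := by
  have hI (t ω) : X t ω ∈ Set.Icc 0 1 := mem_Icc_of_mem_simplex (hK t ω)
  have hI' (t ω) : X' t ω ∈ Set.Icc 0 1 := mem_Icc_of_mem_simplex (hK' t ω)
  have hp : IsStronglyProgressive ℱ X := hprog
  have hp' : IsStronglyProgressive ℱ' X' := hprog'
  have hX (t : ℝ≥0) : Measurable (X t) := ((hp.stronglyAdapted t).mono (ℱ.le t)).measurable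
  have hX' (t : ℝ≥0) : Measurable (X' t) :=
    ((hp'.stronglyAdapted t).mono (ℱ'.le t)).measurable
  have hmoments (t : ℝ≥0) (α : Fin r → ℕ) :
      (∫ ω, ∏ i, (X t ω i) ^ α i ∂μ) = ∫ ω, ∏ i, (X' t ω i) ^ α i ∂μ' := by
    have hinit (w : (Σ i, Fin (α i)) → Fin r) : wordMoment μ X 0 w = wordMoment μ' X' 0 w := by
      have hm : AEStronglyMeasurable (fun x : Fin r → ℝ => ∏ k, x (w k)) (μ.map (X 0)) :=
        (measurable_prod_eval w measurable_id).aestronglyMeasurable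
      have h1 := integral_map (hX 0).aemeasurable hm
      rw [h0] at hm h1
      simp only [wordMoment, Real.toNNReal_zero]
      rw [← h1, integral_map (hX' 0).aemeasurable hm]
    obtain ⟨C, hC, hAC⟩ := exists_norm_entry_le hAcont t
    have hzero := eq_zero_of_abs_deriv_le_mul_abs_self_of_eq_zero_right
      (f := fun s => (wordMoment μ X s - wordMoment μ' X' s : ((Σ i, Fin (α i)) → Fin r) → ℝ))
      (f' := fun s => wordField (A s) (wordMoment μ X s) - wordField (A s) (wordMoment μ' X' s))
      (K := Fintype.card (Σ i, Fin (α i)) * (r * C)) (a := 0) (b := t)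
      (continuous_pi fun w => (continuous_wordMoment hAcont hp hI hmart w).sub
        (continuous_wordMoment hAcont hp' hI' hmart' w)).continuousOn
      (fun s hs => (hasDerivWithinAt_wordMoment hAcont hp hI hmart hs.1).sub
        (hasDerivWithinAt_wordMoment hAcont hp' hI' hmart' hs.1))
      (sub_eq_zero.2 (funext hinit))
      (fun s hs => by
        rw [← wordField_sub]
        exact norm_wordField_le hC (hAC s ⟨hs.1, hs.2.le⟩) _)
      t ⟨t.coe_nonneg, le_rfl⟩
    have heq := congrFun (sub_eq_zero.1 hzero) Sigma.fst
    simp only [wordMoment, Real.toNNReal_coe] at heq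
    simpa only [prod_pow_eq_prod_sigma] using heq
  exact fun t => ⟨hmoments t,
    measure_ext_of_moments μ μ' (hX t) (hX' t) (hI t) (hI' t) (hmoments t)⟩
end
end
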